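/- arXiv:2204.02015 — 5 statements merged into one kernel-verified Lean document; each statement's English description precedes it below -/
import Mathlib

section
/- (Fourier transform of the left ψ-fractional derivative, Lemma 2.1, left identity.) For every v ∈ C_c^∞(ℝ) and every ξ ∈ ℝ with ξ ≠ 0, the Fourier transform of the function s ↦ (_{-∞}D^{δ,ψ}_t v)(ψ^{-1}(s)) satisfies F((_{-∞}D^{δ,ψ}_t v)∘ψ^{-1})(ξ) = (iξ)^δ · F(ṽ)(ξ). -/
open MeasureTheory Real

/-- Fourier transform `F(g)(ξ) = ∫_ℝ g(s) e^{-iξs} ds`. -/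
noncomputable def fourierTransform (g : ℝ → ℝ) (ξ : ℝ) : ℂ :=
  ∫ s : ℝ, (g s : ℂ) * Complex.exp (-(Complex.I * ξ * s))

/-- `(iξ)^μ = |ξ|^μ e^{iπμ·sgn(ξ)/2}`. -/
noncomputable def iXiPow (ξ μ : ℝ) : ℂ :=
  ((|ξ| ^ μ : ℝ) : ℂ) * Complex.exp (Complex.I * (Real.pi * μ * Real.sign ξ / 2))

/-- Left ψ-Riemann–Liouville derivative on the whole line,
`(1/ψ'(t)) d/dt [ (1/Γ(1-μ)) ∫_{-∞}^t ψ'(z)(ψ(t)-ψ(z))^{-μ} v(z) dz ]`. -/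
noncomputable def leftRLDLine (ψ : ℝ → ℝ) (μ : ℝ) (v : ℝ → ℝ) (t : ℝ) : ℝ :=
  (1 / deriv ψ t) *
    deriv (fun τ => (1 / Real.Gamma (1 - μ)) *
      ∫ z in Set.Iio τ, deriv ψ z * (ψ τ - ψ z) ^ (-μ) * v z) t

open scoped Convolution

/-- The kernel of the left fractional integral, without its normalising Gamma factor. -/
noncomputable def rlKernel (δ r : ℝ) : ℝ := (Set.Ioi (0 : ℝ)).indicator (fun r => r ^ (-δ)) r

lemma rlKernel_of_pos {δ r : ℝ} (hr : 0 < r) : rlKernel δ r = r ^ (-δ) := by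
  simp [rlKernel, hr]

lemma rlKernel_of_nonpos {δ r : ℝ} (hr : r ≤ 0) : rlKernel δ r = 0 := by
  simp [rlKernel, hr]

lemma locallyIntegrable_rlKernel {δ : ℝ} (hδ : δ < 1) : LocallyIntegrable (rlKernel δ) := by
  refine LocallyIntegrable.indicator ?_ measurableSet_Ioi
  rw [locallyIntegrable_iff]
  intro K hK
  obtain ⟨a, b, hab⟩ : ∃ a b, K ⊆ Set.Icc a b :=
    bddBelow_bddAbove_iff_subset_Icc.mp ⟨hK.bddBelow, hK.bddAbove⟩
  have h : IntervalIntegrable (fun x : ℝ => x ^ (-δ)) volume (min a b) (max a b) :=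
    intervalIntegral.intervalIntegrable_rpow' (by linarith)
  rw [intervalIntegrable_iff_integrableOn_Icc_of_le min_le_max] at h
  exact h.mono_set (hab.trans (Set.Icc_subset_Icc (min_le_left _ _) (le_max_right _ _)))

lemma measurable_rlKernel (δ : ℝ) : Measurable (rlKernel δ) :=
  Measurable.indicator (by fun_prop) measurableSet_Ioi

lemma rlKernel_nonneg (δ r : ℝ) : 0 ≤ rlKernel δ r :=
  Set.indicator_nonneg (fun _ hr => Real.rpow_nonneg (le_of_lt hr) _) r

lemma integral_rlKernel_mul_exp_ofReal {δ a : ℝ} (hδ : δ < 1) (ha : 0 < a) :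
    ∫ r : ℝ, (rlKernel δ r : ℂ) * Complex.exp (-(a * r))
      = (1 / (a : ℂ)) ^ (1 - δ : ℂ) * Complex.Gamma (1 - δ) := by
  rw [← Complex.integral_cpow_mul_exp_neg_mul_Ioi (by simpa using hδ) ha,
    ← integral_indicator measurableSet_Ioi]
  congr 1 with r
  by_cases hr : 0 < r
  · rw [rlKernel_of_pos hr, Set.indicator_of_mem (Set.mem_Ioi.mpr hr), Complex.ofReal_cpow hr.le]
    simp
  · rw [rlKernel_of_nonpos (not_lt.mp hr), Set.indicator_of_notMem (Set.notMem_Ioi.mpr (not_lt.mp hr))]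
    simp

lemma Gamma_one_sub_ne_zero {δ : ℝ} (hδ : δ < 1) : Complex.Gamma (1 - δ) ≠ 0 :=
  Complex.Gamma_ne_zero_of_re_pos (by simpa using hδ)

lemma integrable_rlKernel_mul_exp {δ : ℝ} (hδ : δ < 1) {z : ℂ} (hz : 0 < z.re) :
    Integrable fun r : ℝ => (rlKernel δ r : ℂ) * Complex.exp (-(z * r)) := by
  have h : Integrable fun r : ℝ => (rlKernel δ r : ℂ) * Complex.exp (-(z.re * r)) := by
    refine Integrable.of_integral_ne_zero ?_
    rw [integral_rlKernel_mul_exp_ofReal hδ hz]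
    exact mul_ne_zero (by simp [Complex.cpow_eq_zero_iff, hz.ne']) (Gamma_one_sub_ne_zero hδ)
  refine h.mono (Measurable.aestronglyMeasurable ?_) (Filter.Eventually.of_forall fun r => ?_)
  · have := measurable_rlKernel δ
    fun_prop
  · simp [Complex.norm_exp]

lemma inv_mem_slitPlane {z : ℂ} (hz : z ∈ Complex.slitPlane) : z⁻¹ ∈ Complex.slitPlane := by
  have hn : 0 < Complex.normSq z := Complex.normSq_pos.mpr (Complex.slitPlane_ne_zero hz)
  rw [Complex.mem_slitPlane_iff] at hz ⊢
  rw [Complex.inv_re, Complex.inv_im]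
  exact hz.imp (fun h => div_pos h hn) fun h => div_ne_zero (neg_ne_zero.mpr h) hn.ne'

/-- The Laplace transform of the kernel, by analytic continuation from the positive half-line. -/
lemma integral_rlKernel_mul_exp {δ : ℝ} (hδ : δ < 1) {z : ℂ} (hz : 0 < z.re) :
    ∫ r : ℝ, (rlKernel δ r : ℂ) * Complex.exp (-(z * r))
      = (1 / z) ^ (1 - δ : ℂ) * Complex.Gamma (1 - δ) := by
  set μ : Measure ℝ := volume.withDensity fun r => ENNReal.ofReal (rlKernel δ r) with hμ
  have hmeas : Measurable fun r => ENNReal.ofReal (rlKernel δ r) :=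
    (measurable_rlKernel δ).ennreal_ofReal
  have hfin : ∀ᵐ r : ℝ, ENNReal.ofReal (rlKernel δ r) < ⊤ := by simp
  have hL : ∀ c : ℂ, ProbabilityTheory.complexMGF (fun r : ℝ => -r) μ c
      = ∫ r : ℝ, (rlKernel δ r : ℂ) * Complex.exp (-(c * r)) := fun c => by
    rw [ProbabilityTheory.complexMGF, hμ,
      integral_withDensity_eq_integral_toReal_smul hmeas hfin]
    congr 1 with r
    simp [ENNReal.toReal_ofReal (rlKernel_nonneg δ r)]
  have hset : Set.Ioi 0 ⊆ ProbabilityTheory.integrableExpSet (fun r : ℝ => -r) μ := by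
    intro a ha
    rw [ProbabilityTheory.integrableExpSet, Set.mem_ofPred_eq, hμ,
      integrable_withDensity_iff_integrable_smul' hmeas hfin]
    have h := (integrable_rlKernel_mul_exp hδ (z := a) (by simpa using ha)).norm
    refine h.congr (Filter.Eventually.of_forall fun r => ?_)
    simp [ENNReal.toReal_ofReal (rlKernel_nonneg δ r), abs_of_nonneg (rlKernel_nonneg δ r),
      Complex.norm_exp]
  have hopen : IsOpen {c : ℂ | 0 < c.re} := isOpen_lt continuous_const Complex.continuous_re
  have hf : AnalyticOnNhd ℂ (ProbabilityTheory.complexMGF (fun r : ℝ => -r) μ)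
      {c : ℂ | 0 < c.re} := fun c hc => ProbabilityTheory.analyticAt_complexMGF
    (interior_maximal hset isOpen_Ioi hc)
  have hg : AnalyticOnNhd ℂ (fun c : ℂ => (1 / c) ^ (1 - δ : ℂ) * Complex.Gamma (1 - δ))
      {c : ℂ | 0 < c.re} := by
    refine DifferentiableOn.analyticOnNhd (fun c hc => ?_) hopen
    have hc0 : c ≠ 0 := fun h => by simp [h] at hc
    have hs : 1 / c ∈ Complex.slitPlane := by
      rw [one_div]
      exact inv_mem_slitPlane (Or.inl hc)
    exact ((((differentiableAt_const _).div differentiableAt_id hc0).cpow_const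
      hs).mul_const _).differentiableWithinAt
  rw [← hL]
  refine hf.eqOn_of_preconnected_of_frequently_eq hg (convex_halfSpace_re_gt 0).isPreconnected
    (z₀ := 1) (by simp) ?_ hz
  have ht : Filter.Tendsto (fun x : ℝ => (x : ℂ)) (nhdsWithin 1 {1}ᶜ) (nhdsWithin 1 {1}ᶜ) := by
    refine tendsto_nhdsWithin_iff.mpr ⟨?_, ?_⟩
    · exact (Complex.continuous_ofReal.tendsto' 1 1 (by simp)).mono_left nhdsWithin_le_nhds
    · filter_upwards [self_mem_nhdsWithin] with x hx
      simpa using hx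
  refine ht.frequently (Filter.Eventually.frequently ?_)
  filter_upwards [nhdsWithin_le_nhds (lt_mem_nhds zero_lt_one)] with x hx
  rw [hL, integral_rlKernel_mul_exp_ofReal hδ hx]

lemma integrable_mul_exp_of_hasCompactSupport {g : ℝ → ℝ} (hg : Continuous g)
    (hs : HasCompactSupport g) (z : ℂ) :
    Integrable fun s : ℝ => (g s : ℂ) * Complex.exp (-(z * s)) := by
  refine Continuous.integrable_of_hasCompactSupport (by fun_prop) ?_
  exact (hs.comp_left (g := fun x : ℝ => (x : ℂ)) (by simp)).mul_right

lemma integral_convolution_rlKernel_mul_exp {δ : ℝ} (hδ : δ < 1) {g : ℝ → ℝ}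
    (hg : Continuous g) (hs : HasCompactSupport g) {z : ℂ} (hz : 0 < z.re) :
    ∫ s : ℝ, ((rlKernel δ ⋆[ContinuousLinearMap.mul ℝ ℝ] g) s : ℂ) * Complex.exp (-(z * s))
      = (1 / z) ^ (1 - δ : ℂ) * Complex.Gamma (1 - δ)
        * ∫ s : ℝ, (g s : ℂ) * Complex.exp (-(z * s)) := by
  have h := integral_convolution (μ := volume) (ν := volume) (ContinuousLinearMap.mul ℝ ℂ)
    (integrable_rlKernel_mul_exp hδ hz) (integrable_mul_exp_of_hasCompactSupport hg hs z)
  rw [ContinuousLinearMap.mul_apply', integral_rlKernel_mul_exp hδ hz] at h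
  rw [← h]
  congr 1 with s
  rw [convolution_def, convolution_def, ← integral_complex_ofReal, ← integral_mul_const]
  congr 1 with r
  have : Complex.exp (-(z * s)) = Complex.exp (-(z * r)) * Complex.exp (-(z * ↑(s - r))) := by
    rw [← Complex.exp_add]; congr 1; push_cast; ring
  simp only [ContinuousLinearMap.mul_apply', this]
  push_cast; ring

lemma integral_deriv_mul_exp {w : ℝ → ℝ} (hw : ContDiff ℝ 1 w) (hs : HasCompactSupport w)
    (z : ℂ) :
    ∫ s : ℝ, ((deriv w s : ℝ) : ℂ) * Complex.exp (-(z * s))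
      = z * ∫ s : ℝ, (w s : ℂ) * Complex.exp (-(z * s)) := by
  have hd : ∀ s : ℝ, HasDerivAt (fun s : ℝ => Complex.exp (-(z * s)))
      (-z * Complex.exp (-(z * s))) s := by
    intro s
    have := (((Complex.ofRealCLM.hasDerivAt (x := s)).const_mul z).neg).cexp
    simpa [mul_comm] using this
  have hw' : ∀ s : ℝ, HasDerivAt (fun s : ℝ => (w s : ℂ)) ((deriv w s : ℝ) : ℂ) s := fun s =>
    ((hw.differentiable one_ne_zero) s).hasDerivAt.ofReal_comp
  have hi := integrable_mul_exp_of_hasCompactSupport hw.continuous hs z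
  have hi' := integrable_mul_exp_of_hasCompactSupport (hw.continuous_deriv le_rfl) hs.deriv z
  have h := integral_mul_deriv_eq_deriv_mul_of_integrable (fun x _ => hw' x) (fun x _ => hd x)
    ?_ hi' hi
  · rw [← integral_const_mul, ← neg_eq_iff_eq_neg.mpr h, ← integral_neg]
    congr 1 with s
    ring
  · convert! hi.const_mul (-z) using 2 with s
    simp only [Pi.mul_apply]
    ring

lemma convolution_rlKernel_eq_zero {δ R s : ℝ} {g : ℝ → ℝ} (hg : ∀ x, x < -R → g x = 0)
    (h : s < -R) : (rlKernel δ ⋆[ContinuousLinearMap.mul ℝ ℝ] g) s = 0 := by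
  rw [convolution_eq_swap]
  refine integral_eq_zero_of_ae (Filter.Eventually.of_forall fun x => ?_)
  rcases le_or_gt s x with hx | hx
  · simp [rlKernel_of_nonpos (sub_nonpos.mpr hx)]
  · simp [hg x (hx.trans h)]

lemma convolution_rlKernel_deriv_of_lt {δ R s : ℝ} {w : ℝ → ℝ}
    (hw : ContDiff ℝ 1 w) (hR : ∀ x ∈ tsupport w, |x| < R) (h : R < s) :
    (rlKernel δ ⋆[ContinuousLinearMap.mul ℝ ℝ] deriv w) s
      = -∫ x in (-R)..R, δ * (s - x) ^ (-δ - 1) * w x := by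
  have h0 : ∀ x, R ≤ |x| → w x = 0 := fun x hx => by
    by_contra hc
    exact absurd (hR x (subset_tsupport w hc)) (not_lt.mpr hx)
  by_cases hR0 : R ≤ 0
  · have : w = 0 := funext fun x => h0 x (hR0.trans (abs_nonneg x))
    simp [this, convolution]
  push Not at hR0
  have hpos : ∀ x ∈ Set.uIcc (-R) R, 0 < s - x := fun x hx => by
    rw [Set.uIcc_of_le (by linarith)] at hx
    linarith [hx.2]
  have hu : ∀ x ∈ Set.uIcc (-R) R,
      HasDerivAt (fun x => (s - x) ^ (-δ)) (δ * (s - x) ^ (-δ - 1)) x := fun x hx => by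
    have := ((hasDerivAt_id x).const_sub s).rpow_const (p := -δ) (Or.inl (hpos x hx).ne')
    simpa using this
  have key := intervalIntegral.integral_mul_deriv_eq_deriv_mul hu
    (fun x _ => ((hw.differentiable one_ne_zero) x).hasDerivAt)
    (ContinuousOn.intervalIntegrable fun x hx => ContinuousAt.continuousWithinAt <|
      continuousAt_const.mul <| (continuousAt_const.sub continuousAt_id).rpow_const
        (Or.inl (hpos x hx).ne'))
    ((hw.continuous_deriv le_rfl).intervalIntegrable _ _)
  rw [h0 R (le_abs_self R), h0 (-R) (by rw [abs_neg]; exact le_abs_self R)] at key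
  rw [mul_zero, mul_zero, sub_zero, zero_sub] at key
  rw [convolution_eq_swap, ← key,
    ← intervalIntegral.integral_eq_integral_of_support_subset (a := -R) (b := R)]
  · refine intervalIntegral.integral_congr fun x hx => ?_
    simp [rlKernel_of_pos (hpos x hx)]
  · intro x hx
    have hx' : x ∈ tsupport w := support_deriv_subset (right_ne_zero_of_mul hx)
    exact ⟨(abs_lt.mp (hR x hx')).1, (abs_lt.mp (hR x hx')).2.le⟩

lemma integrable_convolution_rlKernel_deriv {δ : ℝ} (hδ0 : 0 < δ) (hδ : δ < 1) {w : ℝ → ℝ}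
    (hw : ContDiff ℝ 1 w) (hs : HasCompactSupport w) :
    Integrable (rlKernel δ ⋆[ContinuousLinearMap.mul ℝ ℝ] deriv w) := by
  obtain ⟨R, hR0, hR⟩ := hs.isCompact.isBounded.exists_pos_norm_lt
  simp only [Real.norm_eq_abs] at hR
  obtain ⟨M, hM⟩ := hs.exists_bound_of_continuous hw.continuous
  have hM0 : 0 ≤ M := (norm_nonneg _).trans (hM 0)
  have hcont : Continuous (rlKernel δ ⋆[ContinuousLinearMap.mul ℝ ℝ] deriv w) :=
    hs.deriv.continuous_convolution_right _ (locallyIntegrable_rlKernel hδ)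
      (hw.continuous_deriv le_rfl)
  have hbot : (rlKernel δ ⋆[ContinuousLinearMap.mul ℝ ℝ] deriv w) =O[Filter.atBot]
      (fun _ => (0 : ℝ)) := by
    refine Filter.EventuallyEq.isBigO ?_
    filter_upwards [Filter.Iio_mem_atBot (-R)] with s hs
    refine convolution_rlKernel_eq_zero (fun x hx => ?_) hs
    by_contra hc
    have := (abs_lt.mp (hR x (support_deriv_subset hc))).1
    linarith
  have htop : (rlKernel δ ⋆[ContinuousLinearMap.mul ℝ ℝ] deriv w) =O[Filter.atTop]
      (fun s => s ^ (-δ - 1)) := by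
    refine Asymptotics.IsBigO.of_bound (δ * (1 / 2) ^ (-δ - 1) * M * (2 * R)) ?_
    filter_upwards [Filter.Ioi_mem_atTop (2 * R)] with s hs
    have hs : 2 * R < s := hs
    have hs0 : 0 < s := by linarith
    rw [convolution_rlKernel_deriv_of_lt hw hR (by linarith), norm_neg]
    refine (intervalIntegral.norm_integral_le_of_norm_le_const
      (C := δ * (s / 2) ^ (-δ - 1) * M) fun x hx => ?_).trans_eq ?_
    · rw [Set.uIoc_of_le (by linarith)] at hx
      have hsx : 0 < s - x := by linarith [hx.2]
      rw [norm_mul, norm_mul, Real.norm_of_nonneg hδ0.le,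
        Real.norm_of_nonneg (Real.rpow_nonneg hsx.le _)]
      refine mul_le_mul (mul_le_mul_of_nonneg_left ?_ hδ0.le) (hM x) (norm_nonneg _) ?_
      · exact Real.rpow_le_rpow_of_nonpos (by linarith) (by linarith [hx.2]) (by linarith)
      · exact mul_nonneg hδ0.le (Real.rpow_nonneg (by linarith) _)
    · rw [Real.norm_of_nonneg (Real.rpow_nonneg hs0.le _), abs_of_nonneg (by linarith),
        div_eq_mul_one_div s 2, Real.mul_rpow hs0.le (by norm_num)]
      ring
  refine hcont.locallyIntegrable.integrable_of_isBigO_atBot_atTop hbot ?_ htop ?_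
  · exact (integrable_zero ℝ ℝ volume).integrableAtFilter _
  · rw [integrableAtFilter_rpow_atTop_iff]
    linarith

lemma tendsto_integral_mul_exp {g : ℝ → ℝ} (hg : Integrable g) {R : ℝ} (hR : 0 < R)
    (h0 : ∀ s, s < -R → g s = 0) (ξ : ℝ) :
    Filter.Tendsto (fun ε : ℝ => ∫ s : ℝ, (g s : ℂ) * Complex.exp (-((ε + Complex.I * ξ) * s)))
      (nhdsWithin 0 (Set.Ioi 0)) (nhds (∫ s : ℝ, (g s : ℂ) * Complex.exp (-(Complex.I * ξ * s)))) := by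
  refine tendsto_integral_filter_of_dominated_convergence (fun s => Real.exp R * |g s|) ?_ ?_
    (hg.abs.const_mul _) ?_
  · refine Filter.Eventually.of_forall fun ε => ?_
    exact (Complex.continuous_ofReal.comp_aestronglyMeasurable hg.1).mul
      (Continuous.aestronglyMeasurable (by fun_prop))
  · filter_upwards [Ioo_mem_nhdsGT zero_lt_one] with ε hε
    refine Filter.Eventually.of_forall fun s => ?_
    rcases lt_or_ge s (-R) with h | h
    · simp [h0 s h]
    · rw [norm_mul, Complex.norm_exp, mul_comm, Complex.norm_real, Real.norm_eq_abs]
      refine mul_le_mul_of_nonneg_right (Real.exp_le_exp.mpr ?_) (abs_nonneg _)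
      simp
      nlinarith [hε.1, hε.2]
  · refine Filter.Eventually.of_forall fun s => ?_
    have : Continuous fun ε : ℝ => (g s : ℂ) * Complex.exp (-((ε + Complex.I * ξ) * s)) := by
      fun_prop
    exact (this.tendsto' 0 _ (by simp)).mono_left nhdsWithin_le_nhds

lemma one_div_cpow_mul_self_eq_iXiPow {δ ξ : ℝ} (hξ : ξ ≠ 0) :
    (1 / (Complex.I * ξ)) ^ (1 - δ : ℂ) * (Complex.I * ξ) = iXiPow ξ δ := by
  have hz : Complex.I * ξ ≠ 0 := by simp [hξ]
  have harg : (Complex.I * ξ).arg = Real.pi * Real.sign ξ / 2 := by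
    rcases lt_or_gt_of_ne hξ with h | h
    · rw [Real.sign_of_neg h, show Complex.I * (ξ : ℂ) = ((-ξ : ℝ) : ℂ) * -Complex.I by
        push_cast; ring, Complex.arg_real_mul _ (neg_pos.mpr h), Complex.arg_neg_I]
      ring
    · rw [Real.sign_of_pos h, mul_comm, Complex.arg_real_mul _ h, Complex.arg_I]
      ring
  have hpi : (Complex.I * ξ).arg ≠ Real.pi := by
    have := Real.pi_pos
    rw [harg]
    rcases lt_or_gt_of_ne hξ with h | h
    · rw [Real.sign_of_neg h]; linarith
    · rw [Real.sign_of_pos h]; linarith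
  have hlog : Complex.log (Complex.I * ξ)
      = Real.log |ξ| + (Real.pi * Real.sign ξ / 2) * Complex.I := by
    rw [Complex.log, harg]
    simp
  have h1 : (1 / (Complex.I * ξ)) ^ (1 - δ : ℂ) * (Complex.I * ξ) = (Complex.I * ξ) ^ (δ : ℂ) := by
    rw [one_div, Complex.inv_cpow _ _ hpi, Complex.cpow_sub _ _ hz, Complex.cpow_one]
    rw [inv_div, div_mul_cancel₀ _ hz]
  rw [h1, Complex.cpow_def_of_ne_zero hz, hlog, iXiPow,
    Real.rpow_def_of_pos (abs_pos.mpr hξ), Complex.ofReal_exp, ← Complex.exp_add]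
  congr 1
  push_cast
  ring

lemma fourierTransform_convolution_rlKernel_deriv {δ : ℝ} (hδ0 : 0 < δ) (hδ : δ < 1) {w : ℝ → ℝ}
    (hw : ContDiff ℝ 1 w) (hs : HasCompactSupport w) {ξ : ℝ} (hξ : ξ ≠ 0) :
    fourierTransform (rlKernel δ ⋆[ContinuousLinearMap.mul ℝ ℝ] deriv w) ξ
      = Complex.Gamma (1 - δ) * (iXiPow ξ δ * fourierTransform w ξ) := by
  obtain ⟨R, hR0, hR⟩ := hs.isCompact.isBounded.exists_pos_norm_lt
  have hw0 : ∀ x ∈ tsupport w, ¬ x < -R := fun x hx h => by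
    have := (abs_lt.mp (hR x hx)).1
    linarith
  have hz : Complex.I * ξ ≠ 0 := by simp [hξ]
  have hl := tendsto_integral_mul_exp (integrable_convolution_rlKernel_deriv hδ0 hδ hw hs) hR0
    (fun s => convolution_rlKernel_eq_zero fun x hx => by
      by_contra hc
      exact hw0 x (support_deriv_subset hc) hx) ξ
  have hr := tendsto_integral_mul_exp (hw.continuous.integrable_of_hasCompactSupport hs) hR0
    (fun s h => by
      by_contra hc
      exact hw0 s (subset_tsupport w hc) h) ξ
  have hc : Filter.Tendsto (fun ε : ℝ => (1 / (ε + Complex.I * ξ)) ^ (1 - δ : ℂ)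
      * (ε + Complex.I * ξ)) (nhdsWithin 0 (Set.Ioi 0))
      (nhds ((1 / (Complex.I * ξ)) ^ (1 - δ : ℂ) * (Complex.I * ξ))) := by
    have hid : Filter.Tendsto (fun ε : ℝ => (ε : ℂ) + Complex.I * ξ) (nhdsWithin 0 (Set.Ioi 0))
        (nhds (Complex.I * ξ)) :=
      (Continuous.tendsto' (by fun_prop) 0 _ (by simp)).mono_left nhdsWithin_le_nhds
    refine Filter.Tendsto.mul ?_ hid
    refine (tendsto_const_nhds.div hid hz).cpow tendsto_const_nhds ?_
    rw [one_div]
    exact inv_mem_slitPlane (Or.inr (by simpa using hξ))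
  refine tendsto_nhds_unique hl ?_
  rw [← one_div_cpow_mul_self_eq_iXiPow hξ]
  refine ((hc.mul hr).const_mul (Complex.Gamma (1 - δ))).congr' ?_
  filter_upwards [self_mem_nhdsWithin] with ε hε
  rw [integral_convolution_rlKernel_mul_exp hδ (hw.continuous_deriv le_rfl) hs.deriv
    (by simpa using hε), integral_deriv_mul_exp hw hs]
  ring

lemma leftRLDLine_eq_convolution {δ : ℝ} (hδ : δ < 1) {ψ w : ℝ → ℝ} (hψ : ContDiff ℝ 1 ψ)
    (hmono : StrictMono ψ) (hsurj : Function.Surjective ψ) (hψ' : ∀ t, 0 < deriv ψ t)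
    (hw : ContDiff ℝ 1 w) (hs : HasCompactSupport w) (t : ℝ) :
    leftRLDLine ψ δ (w ∘ ψ) t = 1 / Real.Gamma (1 - δ)
      * (rlKernel δ ⋆[ContinuousLinearMap.mul ℝ ℝ] deriv w) (ψ t) := by
  have hI : ∀ τ, ∫ z in Set.Iio τ, deriv ψ z * (ψ τ - ψ z) ^ (-δ) * (w ∘ ψ) z
      = (rlKernel δ ⋆[ContinuousLinearMap.mul ℝ ℝ] w) (ψ τ) := fun τ => by
    have himg : ψ '' Set.Iio τ = Set.Iio (ψ τ) :=
      (hmono.orderIsoOfSurjective ψ hsurj).image_Iio τ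
    have h := integral_image_eq_integral_abs_deriv_smul (s := Set.Iio τ) measurableSet_Iio
      (fun x _ => ((hψ.differentiable one_ne_zero) x).hasDerivAt.hasDerivWithinAt)
      hmono.injective.injOn (fun σ => (ψ τ - σ) ^ (-δ) * w σ)
    rw [himg, ← integral_indicator measurableSet_Iio] at h
    rw [convolution_eq_swap]
    refine Eq.trans ?_ (h.symm.trans ?_)
    · congr 1 with z
      simp [abs_of_pos (hψ' z), mul_assoc]
    · congr 1 with σ
      by_cases hσ : σ < ψ τ
      · rw [Set.indicator_of_mem (Set.mem_Iio.mpr hσ)]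
        simp [rlKernel_of_pos (sub_pos.mpr hσ)]
      · rw [Set.indicator_of_notMem (Set.notMem_Iio.mpr (not_lt.mp hσ))]
        simp [rlKernel_of_nonpos (sub_nonpos.mpr (not_lt.mp hσ))]
  have hd := ((hs.hasDerivAt_convolution_right (ContinuousLinearMap.mul ℝ ℝ)
    (locallyIntegrable_rlKernel hδ) hw (ψ t)).comp t
    ((hψ.differentiable one_ne_zero) t).hasDerivAt).const_mul (1 / Real.Gamma (1 - δ))
  simp only [leftRLDLine, hI]
  have hne := (hψ' t).ne'
  simp only [Function.comp_apply] at hd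
  rw [hd.deriv]
  field_simp

theorem fourier_of_left_psi_fractional_derivative
    (δ : ℝ) (hδ0 : 0 < δ) (hδ1 : δ < 1)
    (ψ ψinv : ℝ → ℝ) (hψ : ContDiff ℝ 1 ψ) (hmono : StrictMono ψ)
    (hbij : Function.Bijective ψ) (hψ' : ∀ t, 0 < deriv ψ t)
    (hinvl : Function.LeftInverse ψinv ψ) (hinvr : Function.RightInverse ψinv ψ)
    (v : ℝ → ℝ) (hv : ContDiff ℝ (⊤ : ℕ∞) v) (hsupp : HasCompactSupport v)
    (ξ : ℝ) (hξ : ξ ≠ 0) :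
    fourierTransform (fun s => leftRLDLine ψ δ v (ψinv s)) ξ
      = iXiPow ξ δ * fourierTransform (fun s => v (ψinv s)) ξ := by
  let e : ℝ ≃ₜ ℝ := (hmono.orderIsoOfSurjective ψ hbij.2).toHomeomorph
  have he : ⇑e.symm = ψinv := funext fun s => by
    rw [Homeomorph.symm_apply_eq]
    exact (hinvr s).symm
  have hinv : ContDiff ℝ 1 ψinv := he ▸ e.contDiff_symm_deriv (fun t => (hψ' t).ne')
    (fun t => ((hψ.differentiable one_ne_zero) t).hasDerivAt) hψ
  have hw : ContDiff ℝ 1 (v ∘ ψinv) := (hv.of_le (by exact_mod_cast le_top)).comp hinv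
  have hs : HasCompactSupport (v ∘ ψinv) := he ▸ hsupp.comp_homeomorph e.symm
  have hv' : v = (v ∘ ψinv) ∘ ψ := funext fun t => by simp [hinvl t]
  have hfun : (fun s => leftRLDLine ψ δ v (ψinv s)) = fun s => 1 / Real.Gamma (1 - δ)
      * (rlKernel δ ⋆[ContinuousLinearMap.mul ℝ ℝ] deriv (v ∘ ψinv)) s := funext fun s => by
    conv_lhs => rw [hv']
    rw [leftRLDLine_eq_convolution hδ1 hψ hmono hbij.2 hψ' hw hs, hinvr s]
  have hΓ := Gamma_one_sub_ne_zero hδ1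
  have h := fourierTransform_convolution_rlKernel_deriv hδ0 hδ1 hw hs hξ
  have hmul : ∀ (c : ℝ) (g : ℝ → ℝ),
      fourierTransform (fun s => c * g s) ξ = c * fourierTransform g ξ := fun c g => by
    simp only [fourierTransform, Complex.ofReal_mul, mul_assoc, integral_const_mul]
  rw [hfun, hmul, h]
  push_cast [← Complex.Gamma_ofReal]
  rw [one_div, inv_mul_cancel_left₀ hΓ]
  rfl
end

section
/- (Fourier transform of the right ψ-fractional derivative, Lemma 2.1, right identity.) For every v ∈ C_c^∞(ℝ) and every ξ ∈ ℝ with ξ ≠ 0, the Fourier transform of the function s ↦ (_tD^{δ,ψ}_{+∞} v)(ψ^{-1}(s)) satisfies F((_tD^{δ,ψ}_{+∞} v)∘ψ^{-1})(ξ) = (-iξ)^δ · F(ṽ)(ξ). -/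
open MeasureTheory Real

/-- `(-iξ)^μ = |ξ|^μ e^{-iπμ·sgn(ξ)/2}`. -/
noncomputable def negIXiPow (ξ μ : ℝ) : ℂ :=
  ((|ξ| ^ μ : ℝ) : ℂ) * Complex.exp (-(Complex.I * (Real.pi * μ * Real.sign ξ / 2)))

/-- Right ψ-Riemann–Liouville derivative on the whole line,
`-(1/ψ'(t)) d/dt [ (1/Γ(1-μ)) ∫_t^{+∞} ψ'(z)(ψ(z)-ψ(t))^{-μ} v(z) dz ]`. -/
noncomputable def rightRLDLine (ψ : ℝ → ℝ) (μ : ℝ) (v : ℝ → ℝ) (t : ℝ) : ℝ :=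
  -(1 / deriv ψ t) *
    deriv (fun τ => (1 / Real.Gamma (1 - μ)) *
      ∫ z in Set.Ioi τ, deriv ψ z * (ψ z - ψ τ) ^ (-μ) * v z) t

open Set Filter Topology

theorem norm_rpow_mul_cexp_neg_mul {b t : ℝ} (c : ℂ) (ht : 0 < t) :
    ‖((t ^ b : ℝ) : ℂ) * Complex.exp (-(c * t))‖ = t ^ b * Real.exp (-c.re * t) := by
  rw [norm_mul, Complex.norm_exp, Complex.norm_real, Real.norm_of_nonneg (Real.rpow_nonneg ht.le b)]
  simp

theorem integrableOn_rpow_mul_exp_neg_mul {b r : ℝ} (hb : -1 < b) (hr : 0 < r) :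
    IntegrableOn (fun t : ℝ => t ^ b * Real.exp (-r * t)) (Ioi 0) := by
  simpa using integrableOn_rpow_mul_exp_neg_mul_rpow hb one_pos hr

theorem aestronglyMeasurable_rpow_mul_cexp_neg_mul (b : ℝ) (c : ℂ) (μ : Measure ℝ) :
    AEStronglyMeasurable (fun t : ℝ => ((t ^ b : ℝ) : ℂ) * Complex.exp (-(c * t))) μ := by
  have : Measurable fun t : ℝ => ((t ^ b : ℝ) : ℂ) * Complex.exp (-(c * t)) := by fun_prop
  exact this.aestronglyMeasurable

theorem integrableOn_rpow_mul_cexp_neg_mul {b : ℝ} {c : ℂ} (hb : -1 < b) (hc : 0 < c.re) :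
    IntegrableOn (fun t : ℝ => ((t ^ b : ℝ) : ℂ) * Complex.exp (-(c * t))) (Ioi 0) := by
  refine (integrableOn_rpow_mul_exp_neg_mul hb hc).mono'
    (aestronglyMeasurable_rpow_mul_cexp_neg_mul b c _) ?_
  filter_upwards [ae_restrict_mem measurableSet_Ioi] with t ht
  exact (norm_rpow_mul_cexp_neg_mul c ht).le

theorem differentiableAt_integral_rpow_mul_cexp_neg_mul {b : ℝ} {c : ℂ} (hb : -1 < b)
    (hc : 0 < c.re) :
    DifferentiableAt ℂ
      (fun z : ℂ => ∫ t in Ioi (0 : ℝ), ((t ^ b : ℝ) : ℂ) * Complex.exp (-(z * t))) c := by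
  have key := hasDerivAt_integral_of_dominated_loc_of_deriv_le (𝕜 := ℂ)
    (μ := volume.restrict (Ioi (0 : ℝ)))
    (F := fun (z : ℂ) (t : ℝ) => ((t ^ b : ℝ) : ℂ) * Complex.exp (-(z * t)))
    (F' := fun (z : ℂ) (t : ℝ) => ((t ^ b : ℝ) : ℂ) * (Complex.exp (-(z * t)) * -(t : ℂ)))
    (x₀ := c) (s := Metric.ball c (c.re / 2))
    (bound := fun t => t ^ (b + 1) * Real.exp (-(c.re / 2) * t))
    (Metric.ball_mem_nhds _ (by positivity))
    (Eventually.of_forall fun z => aestronglyMeasurable_rpow_mul_cexp_neg_mul b z _)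
    (integrableOn_rpow_mul_cexp_neg_mul hb hc) ?_ ?_
    (integrableOn_rpow_mul_exp_neg_mul (by linarith) (by positivity)) ?_
  · exact key.2.differentiableAt
  · have : Measurable fun t : ℝ =>
        ((t ^ b : ℝ) : ℂ) * (Complex.exp (-(c * t)) * -(t : ℂ)) := by fun_prop
    exact this.aestronglyMeasurable
  · filter_upwards [ae_restrict_mem measurableSet_Ioi] with t ht z hz
    have ht0 : (0 : ℝ) < t := ht
    rw [← mul_assoc, norm_mul, norm_rpow_mul_cexp_neg_mul z ht, norm_neg, Complex.norm_real,
      Real.norm_of_nonneg ht0.le, Real.rpow_add_one ht0.ne', mul_right_comm]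
    have h1 : |(z - c).re| < c.re / 2 :=
      (Complex.abs_re_le_norm _).trans_lt (by simpa [dist_eq_norm] using hz)
    have h2 : c.re / 2 ≤ z.re := by
      rw [abs_lt, Complex.sub_re] at h1
      linarith
    gcongr
  · refine Eventually.of_forall fun t z _ => ?_
    have h : HasDerivAt (fun z : ℂ => -(z * (t : ℂ))) (-(t : ℂ)) z := by
      simpa using ((hasDerivAt_id z).mul_const (t : ℂ)).fun_neg
    exact h.cexp.const_mul _

theorem integral_rpow_mul_cexp_neg_mul_Ioi {a : ℝ} {c : ℂ} (ha : 0 < a) (hc : 0 < c.re) :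
    ∫ t in Ioi (0 : ℝ), ((t ^ (a - 1) : ℝ) : ℂ) * Complex.exp (-(c * t))
      = c ^ (-a : ℂ) * Real.Gamma a := by
  have hopen : IsOpen {z : ℂ | 0 < z.re} := isOpen_lt continuous_const Complex.continuous_re
  have hconn : IsPreconnected {z : ℂ | 0 < z.re} := (convex_halfSpace_re_gt 0).isPreconnected
  have hf : AnalyticOnNhd ℂ (fun z : ℂ =>
      ∫ t in Ioi (0 : ℝ), ((t ^ (a - 1) : ℝ) : ℂ) * Complex.exp (-(z * t))) {z | 0 < z.re} :=
    DifferentiableOn.analyticOnNhd (fun z hz =>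
      (differentiableAt_integral_rpow_mul_cexp_neg_mul (by linarith)
        hz).differentiableWithinAt) hopen
  have hg : AnalyticOnNhd ℂ (fun z : ℂ => z ^ (-a : ℂ) * Real.Gamma a) {z | 0 < z.re} :=
    DifferentiableOn.analyticOnNhd (fun z hz =>
      ((differentiableAt_id.cpow_const (Or.inl hz)).mul_const _).differentiableWithinAt) hopen
  have hreal : ∀ r : ℝ, 0 < r →
      ∫ t in Ioi (0 : ℝ), ((t ^ (a - 1) : ℝ) : ℂ) * Complex.exp (-((r : ℂ) * t))
        = (r : ℂ) ^ (-a : ℂ) * Real.Gamma a := by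
    intro r hr
    have h := Real.integral_rpow_mul_exp_neg_mul_Ioi ha hr
    have h' := congrArg (fun x : ℝ => (x : ℂ)) h
    rw [one_div, Real.inv_rpow hr.le, ← Real.rpow_neg hr.le] at h'
    simp only [Complex.ofReal_mul, Complex.ofReal_cpow hr.le, Complex.ofReal_neg] at h'
    rw [← h', ← integral_complex_ofReal]
    simp
  refine hf.eqOn_of_preconnected_of_frequently_eq hg hconn (z₀ := 1) (by simp) ?_ hc
  have ht : Tendsto (fun r : ℝ => (r : ℂ)) (𝓝[>] 1) (𝓝[≠] 1) := by
    refine tendsto_nhdsWithin_iff.2 ⟨?_, ?_⟩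
    · exact (Complex.continuous_ofReal.tendsto' 1 1 (by simp)).mono_left nhdsWithin_le_nhds
    · filter_upwards [self_mem_nhdsWithin] with r hr
      have : r ≠ 1 := ne_of_gt hr
      simpa using this
  refine ht.frequently (Eventually.frequently ?_)
  filter_upwards [self_mem_nhdsWithin] with r hr
  exact hreal r (one_pos.trans hr)

/-- The kernel `t ↦ t^{-δ}` on the positive half-line, extended by zero. -/
noncomputable def powKernel (δ : ℝ) : ℝ → ℝ :=
  (Ioi 0).indicator fun r => r ^ (-δ)

theorem locallyIntegrable_powKernel {δ : ℝ} (hδ : δ < 1) : LocallyIntegrable (powKernel δ) := by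
  refine locallyIntegrable_iff.2 fun K hK => ?_
  obtain ⟨R, hR⟩ := hK.isBounded.subset_closedBall 0
  rw [Real.closedBall_eq_Icc] at hR
  refine IntegrableOn.mono_set ?_ (hR.trans (Icc_subset_Icc_right (le_max_left (0 + R) (0 - R))))
  refine Integrable.indicator ?_ measurableSet_Ioi
  exact (intervalIntegrable_iff_integrableOn_Icc_of_le (le_max_right _ _)).1
    (intervalIntegral.intervalIntegrable_rpow' (by linarith))

theorem convolution_powKernel_apply (δ : ℝ) (g : ℝ → ℝ) (x : ℝ) :
    convolution (powKernel δ) g (ContinuousLinearMap.mul ℝ ℝ) volume x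
      = ∫ r in Ioi (0 : ℝ), r ^ (-δ) * g (x - r) := by
  rw [← integral_indicator measurableSet_Ioi]
  simp only [convolution, powKernel, ContinuousLinearMap.mul_apply', indicator_mul_left]

theorem convolution_powKernel_eq_zero (δ : ℝ) {g : ℝ → ℝ} {R x : ℝ} (hg : ∀ y < -R, g y = 0)
    (hx : x < -R) :
    convolution (powKernel δ) g (ContinuousLinearMap.mul ℝ ℝ) volume x = 0 := by
  rw [convolution_powKernel_apply]
  refine setIntegral_eq_zero_of_forall_eq_zero fun r hr => ?_
  rw [hg _ (by linarith [mem_Ioi.1 hr]), mul_zero]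

theorem setIntegral_Ioi_one_rpow_mul_deriv {δ : ℝ} {W : ℝ → ℝ} (hW : ContDiff ℝ 1 W)
    (hWc : HasCompactSupport W) (x : ℝ) :
    ∫ r in Ioi (1 : ℝ), r ^ (-δ) * deriv W (x - r)
      = W (x - 1) - δ * ∫ r in Ioi (1 : ℝ), r ^ (-δ - 1) * W (x - r) := by
  have hcomp : HasCompactSupport fun r => W (x - r) := hWc.comp_homeomorph (Homeomorph.subLeft x)
  have hcomp' : HasCompactSupport fun r => deriv W (x - r) :=
    hWc.deriv.comp_homeomorph (Homeomorph.subLeft x)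
  have hint : ∀ (b : ℝ) (g : ℝ → ℝ), Continuous g → HasCompactSupport g →
      IntegrableOn (fun r => r ^ b * g r) (Ioi 1) := by
    intro b g hg hgc
    refine IntegrableOn.mono_set ?_ Ioi_subset_Ici_self
    obtain ⟨R, hR⟩ := hgc.isCompact.isBounded.subset_closedBall 0
    have h1 : IntegrableOn (fun r => r ^ b * g r) (Icc 1 (max 1 R)) :=
      (ContinuousOn.mul (continuousOn_id.rpow_const fun r hr =>
        Or.inl (by have : (1 : ℝ) ≤ r := hr.1; simp only [id]; positivity))
        hg.continuousOn).integrableOn_Icc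
    refine h1.of_forall_sdiff_eq_zero measurableSet_Ici fun r hr => ?_
    have : g r = 0 := by
      refine image_eq_zero_of_notMem_tsupport fun h => hr.2 ⟨hr.1, ?_⟩
      have := hR h
      rw [Real.closedBall_eq_Icc] at this
      exact le_max_of_le_right (by linarith [this.2])
    rw [this, mul_zero]
  have h := integral_Ioi_mul_deriv_eq_deriv_mul (a := 1) (a' := -W (x - 1)) (b' := 0)
    (u := fun r : ℝ => r ^ (-δ)) (u' := fun r => -δ * r ^ (-δ - 1))
    (v := fun r => -W (x - r)) (v' := fun r => deriv W (x - r)) ?_ ?_ ?_ ?_ ?_ ?_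
  · rw [h, ← integral_const_mul, zero_sub, neg_neg]
    congr 2 with r
    ring
  · intro r hr
    exact Real.hasDerivAt_rpow_const (Or.inl (one_pos.trans hr).ne')
  · intro r _
    have h1 := (hW.differentiable one_ne_zero (x - r)).hasDerivAt
    simpa using (h1.comp_const_sub x r).fun_neg
  · exact hint _ _ ((hW.continuous_deriv le_rfl).comp (by fun_prop)) hcomp'
  · have := (hint (-δ - 1) _ (hW.continuous.comp (by fun_prop)) hcomp).const_mul δ
    refine this.congr (Eventually.of_forall fun r => ?_)
    simp only [Pi.mul_apply]
    simp
    ring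
  · have hc : ContinuousAt (fun r : ℝ => r ^ (-δ) * -W (x - r)) 1 :=
      (continuousAt_id.rpow_const (Or.inl one_ne_zero)).mul
        (hW.continuous.comp (by fun_prop : Continuous fun r => x - r)).neg.continuousAt
    have := hc.tendsto.mono_left (nhdsWithin_le_nhds (s := Ioi 1))
    simp only [Real.one_rpow, one_mul] at this
    exact this
  · have : (fun r : ℝ => r ^ (-δ) * -W (x - r)) =ᶠ[atTop] fun _ => 0 := by
      have h0 := hasCompactSupport_iff_eventuallyEq.1 hcomp
      rw [coclosedCompact_eq_cocompact] at h0
      filter_upwards [atTop_le_cocompact h0] with r hr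
      simp_all
    exact tendsto_const_nhds.congr' this.symm

theorem integrable_convolution_powKernel_deriv {δ : ℝ} (hδ0 : 0 < δ) (hδ1 : δ < 1) {W : ℝ → ℝ}
    (hW : ContDiff ℝ 1 W) (hWc : HasCompactSupport W) :
    Integrable (convolution (powKernel δ) (deriv W) (ContinuousLinearMap.mul ℝ ℝ) volume) := by
  have hW' : Continuous (deriv W) := hW.continuous_deriv le_rfl
  have hWi : Integrable W := hW.continuous.integrable_of_hasCompactSupport hWc
  have hW'i : Integrable (deriv W) := hW'.integrable_of_hasCompactSupport hWc.deriv
  have hsing : Integrable ((Ioc 0 1).indicator fun r : ℝ => r ^ (-δ)) := by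
    rw [integrable_indicator_iff measurableSet_Ioc,
      ← intervalIntegrable_iff_integrableOn_Ioc_of_le zero_le_one]
    exact intervalIntegral.intervalIntegrable_rpow' (by linarith)
  have htail : Integrable ((Ioi 1).indicator fun r : ℝ => r ^ (-δ - 1)) := by
    rw [integrable_indicator_iff measurableSet_Ioi]
    exact integrableOn_Ioi_rpow_of_lt (by linarith) one_pos
  have h1 := hsing.integrable_convolution (ContinuousLinearMap.mul ℝ ℝ) hW'i
  have h2 := htail.integrable_convolution (ContinuousLinearMap.mul ℝ ℝ) hWi
  refine (h1.add ((hWi.comp_sub_right 1).sub (h2.const_mul δ))).congr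
    (Eventually.of_forall fun x => ?_)
  have hex := hWc.deriv.convolutionExists_right (ContinuousLinearMap.mul ℝ ℝ)
    (locallyIntegrable_powKernel hδ1) hW' x
  have hon : IntegrableOn (fun r : ℝ => r ^ (-δ) * deriv W (x - r)) (Ioi 0) := by
    rw [← integrable_indicator_iff measurableSet_Ioi]
    refine hex.congr (Eventually.of_forall fun r => ?_)
    simp only [powKernel, ContinuousLinearMap.mul_apply', indicator_mul_left]
  have hsplit : ∀ (s : Set ℝ) (f g : ℝ → ℝ), MeasurableSet s →
      convolution (s.indicator f) g (ContinuousLinearMap.mul ℝ ℝ) volume x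
        = ∫ r in s, f r * g (x - r) := by
    intro s f g hs
    rw [← integral_indicator hs]
    simp only [convolution, ContinuousLinearMap.mul_apply', indicator_mul_left]
  simp only [Pi.add_apply, Pi.sub_apply]
  rw [hsplit _ _ _ measurableSet_Ioc, hsplit _ _ _ measurableSet_Ioi,
    ← setIntegral_Ioi_one_rpow_mul_deriv hW hWc, convolution_powKernel_apply,
    ← Ioc_union_Ioi_eq_Ioi (zero_le_one (α := ℝ)),
    setIntegral_union (Ioc_disjoint_Ioi le_rfl) measurableSet_Ioi
      (hon.mono_set Ioc_subset_Ioi_self) (hon.mono_set (Ioi_subset_Ioi zero_le_one))]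

theorem integral_deriv_mul_cexp {W : ℝ → ℝ} (hW : ContDiff ℝ 1 W) (hWc : HasCompactSupport W)
    (c : ℂ) :
    ∫ x : ℝ, ((deriv W x : ℝ) : ℂ) * Complex.exp (-(c * x))
      = c * ∫ x : ℝ, (W x : ℂ) * Complex.exp (-(c * x)) := by
  have hexp : Continuous fun x : ℝ => Complex.exp (-(c * x)) := by fun_prop
  have hint : ∀ g : ℝ → ℝ, Continuous g → HasCompactSupport g →
      Integrable fun x : ℝ => (g x : ℂ) * Complex.exp (-(c * x)) := fun g hg hgc =>
    ((Complex.continuous_ofReal.comp hg).mul hexp).integrable_of_hasCompactSupport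
      ((hgc.comp_left Complex.ofReal_zero).mul_right)
  have h := integral_mul_deriv_eq_deriv_mul_of_integrable
    (u := fun x : ℝ => (W x : ℂ)) (u' := fun x => ((deriv W x : ℝ) : ℂ))
    (v := fun x : ℝ => Complex.exp (-(c * x))) (v' := fun x => Complex.exp (-(c * x)) * -c)
    (fun x _ => (hW.differentiable one_ne_zero x).hasDerivAt.ofReal_comp)
    (fun x _ => ?_) ?_ (hint _ (hW.continuous_deriv le_rfl) hWc.deriv)
    (hint _ hW.continuous hWc)
  · rw [← neg_eq_iff_eq_neg] at h
    rw [← h, ← integral_neg, ← integral_const_mul]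
    congr 1 with x
    ring
  · have h1 : HasDerivAt (fun x : ℝ => -(c * (x : ℂ))) (-c) x := by
      simpa using ((hasDerivAt_id x).ofReal_comp.const_mul c).fun_neg
    exact h1.cexp
  · refine ((hint _ hW.continuous hWc).mul_const (-c)).congr (Eventually.of_forall fun x => ?_)
    simp only [Pi.mul_apply]
    ring

/-- The bilateral Laplace transform of the fractional derivative, in the open right half-plane. -/
theorem laplace_convolution_powKernel_deriv {δ : ℝ} (hδ1 : δ < 1) {W : ℝ → ℝ}
    (hW : ContDiff ℝ 1 W) (hWc : HasCompactSupport W) {c : ℂ} (hc : 0 < c.re) :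
    ∫ x : ℝ, ((convolution (powKernel δ) (deriv W) (ContinuousLinearMap.mul ℝ ℝ) volume x : ℝ) : ℂ)
        * Complex.exp (-(c * x))
      = Real.Gamma (1 - δ) * c ^ (δ : ℂ) * ∫ x : ℝ, (W x : ℂ) * Complex.exp (-(c * x)) := by
  have hk : Integrable ((Ioi (0 : ℝ)).indicator
      fun t : ℝ => ((t ^ (-δ) : ℝ) : ℂ) * Complex.exp (-(c * t))) :=
    (integrable_indicator_iff measurableSet_Ioi).2
      (integrableOn_rpow_mul_cexp_neg_mul (by linarith) hc)
  have hg : Integrable fun x : ℝ => ((deriv W x : ℝ) : ℂ) * Complex.exp (-(c * x)) :=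
    ((Complex.continuous_ofReal.comp (hW.continuous_deriv le_rfl)).mul
      (by fun_prop)).integrable_of_hasCompactSupport
      ((hWc.deriv.comp_left Complex.ofReal_zero).mul_right)
  have h := integral_convolution (ContinuousLinearMap.mul ℝ ℂ) hk hg
  have hG := integral_rpow_mul_cexp_neg_mul_Ioi (a := 1 - δ) (by linarith) hc
  rw [show 1 - δ - 1 = -δ by ring] at hG
  rw [ContinuousLinearMap.mul_apply', integral_indicator measurableSet_Ioi, hG,
    integral_deriv_mul_cexp hW hWc] at h
  have hc0 : c ≠ 0 := by
    rintro rfl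
    simp at hc
  have hpow : c ^ (δ : ℂ) = c ^ (-((1 - δ : ℝ) : ℂ)) * c := by
    nth_rw 3 [← Complex.cpow_one c]
    rw [← Complex.cpow_add _ _ hc0]
    congr 1
    push_cast
    ring
  calc _ = _ := integral_congr_ae (Eventually.of_forall fun x => ?_)
    _ = _ := h
    _ = _ := by rw [hpow]; ring
  simp only [convolution, ContinuousLinearMap.mul_apply', powKernel]
  rw [← integral_complex_ofReal, ← integral_mul_const]
  congr 1 with r
  by_cases hr : r ∈ Ioi (0 : ℝ)
  · simp only [indicator_of_mem hr]
    have : Complex.exp (-(c * x)) = Complex.exp (-(c * r)) * Complex.exp (-(c * (x - r : ℝ))) := by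
      rw [← Complex.exp_add]
      congr 1
      push_cast
      ring
    rw [this]
    push_cast
    ring
  · simp [indicator_of_notMem hr]

theorem tendsto_integral_mul_cexp {f : ℝ → ℝ} (hf : Integrable f) {R : ℝ}
    (hR : ∀ x < -R, f x = 0) (η : ℝ) :
    Tendsto (fun ε : ℝ => ∫ x : ℝ, (f x : ℂ) * Complex.exp (-((ε + Complex.I * η) * x)))
      (𝓝[>] 0) (𝓝 (∫ x : ℝ, (f x : ℂ) * Complex.exp (-(Complex.I * η * x)))) := by
  refine tendsto_integral_filter_of_dominated_convergence (fun x => ‖f x‖ * Real.exp |R|)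
    (Eventually.of_forall fun ε => ?_) ?_ (hf.norm.mul_const _)
    (Eventually.of_forall fun x => ?_)
  · exact (Complex.continuous_ofReal.comp_aestronglyMeasurable hf.1).mul
      (Continuous.aestronglyMeasurable (by fun_prop))
  · filter_upwards [Ioo_mem_nhdsGT (one_pos (α := ℝ))] with ε hε
    refine Eventually.of_forall fun x => ?_
    rw [norm_mul, Complex.norm_real]
    rcases lt_or_ge x (-R) with hx | hx
    · simp [hR x hx]
    · gcongr
      rw [Complex.norm_exp, Real.exp_le_exp]
      simp only [Complex.neg_re, Complex.mul_re, Complex.add_re, Complex.ofReal_re, Complex.I_re,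
        Complex.I_im, Complex.ofReal_im, Complex.add_im, Complex.mul_im]
      have h1 : -x ≤ |R| := by linarith [le_abs_self R]
      nlinarith [hε.1, hε.2, abs_nonneg R, mul_le_mul_of_nonneg_left h1 hε.1.le]
  · have hc : Continuous fun ε : ℝ =>
        (f x : ℂ) * Complex.exp (-((ε + Complex.I * η) * x)) := by fun_prop
    exact (hc.tendsto' 0 _ (by simp)).mono_left nhdsWithin_le_nhds

theorem fourier_convolution_powKernel_deriv {δ : ℝ} (hδ0 : 0 < δ) (hδ1 : δ < 1) {W : ℝ → ℝ}
    (hW : ContDiff ℝ 1 W) (hWc : HasCompactSupport W) {η : ℝ} (hη : η ≠ 0) :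
    ∫ x : ℝ, ((convolution (powKernel δ) (deriv W) (ContinuousLinearMap.mul ℝ ℝ) volume x : ℝ) : ℂ)
        * Complex.exp (-(Complex.I * η * x))
      = Real.Gamma (1 - δ) * (Complex.I * η) ^ (δ : ℂ) *
        ∫ x : ℝ, (W x : ℂ) * Complex.exp (-(Complex.I * η * x)) := by
  have hbound : ∀ g : ℝ → ℝ, HasCompactSupport g → ∃ R, ∀ x < -R, g x = 0 := by
    intro g hg
    obtain ⟨R, hR⟩ := hg.isCompact.isBounded.subset_closedBall 0
    refine ⟨R, fun x hx => image_eq_zero_of_notMem_tsupport fun h => ?_⟩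
    have := hR h
    rw [Real.closedBall_eq_Icc] at this
    linarith [this.1]
  obtain ⟨R, hR⟩ := hbound W hWc
  obtain ⟨R', hR'⟩ := hbound _ hWc.deriv
  have hleft := tendsto_integral_mul_cexp (integrable_convolution_powKernel_deriv hδ0 hδ1 hW hWc)
    (fun x hx => convolution_powKernel_eq_zero δ hR' hx) η
  have hright := tendsto_integral_mul_cexp (hW.continuous.integrable_of_hasCompactSupport hWc) hR η
  have hpow : Tendsto (fun ε : ℝ => ((ε : ℂ) + Complex.I * η) ^ (δ : ℂ)) (𝓝[>] 0)
      (𝓝 ((Complex.I * η) ^ (δ : ℂ))) := by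
    have h1 : Tendsto (fun ε : ℝ => (ε : ℂ) + Complex.I * η) (𝓝[>] 0) (𝓝 (Complex.I * η)) :=
      ((by fun_prop : Continuous fun ε : ℝ => (ε : ℂ) + Complex.I * η).tendsto' 0 _
        (by simp)).mono_left nhdsWithin_le_nhds
    exact h1.cpow tendsto_const_nhds (Or.inr (by simpa using hη))
  refine tendsto_nhds_unique hleft (((hpow.const_mul _).mul hright).congr' ?_)
  filter_upwards [self_mem_nhdsWithin] with ε hε
  exact (laplace_convolution_powKernel_deriv hδ1 hW hWc (by simpa using hε)).symm

theorem setIntegral_psi_kernel_eq_convolution (δ : ℝ) {ψ ψinv : ℝ → ℝ} (hψ : Differentiable ℝ ψ)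
    (hmono : StrictMono ψ) (hinvl : Function.LeftInverse ψinv ψ)
    (hinvr : Function.RightInverse ψinv ψ) (v : ℝ → ℝ) (τ : ℝ) :
    ∫ z in Ioi τ, deriv ψ z * (ψ z - ψ τ) ^ (-δ) * v z
      = convolution (powKernel δ) (fun x => v (ψinv (-x))) (ContinuousLinearMap.mul ℝ ℝ) volume
          (-ψ τ) := by
  have himage : (fun z => ψ z - ψ τ) '' Ioi τ = Ioi 0 := by
    ext u
    constructor
    · rintro ⟨z, hz, rfl⟩
      exact sub_pos.2 (hmono hz)
    · intro hu
      refine ⟨ψinv (u + ψ τ), ?_, by simp [hinvr (u + ψ τ)]⟩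
      rw [mem_Ioi, ← hmono.lt_iff_lt, hinvr (u + ψ τ)]
      linarith [mem_Ioi.1 hu]
  rw [convolution_powKernel_apply, ← himage, integral_image_eq_integral_abs_deriv_smul
    measurableSet_Ioi (fun z _ => ((hψ z).hasDerivAt.sub_const (ψ τ)).hasDerivWithinAt)
    (fun z _ y _ h => hmono.injective (sub_left_injective h))]
  refine integral_congr_ae (Eventually.of_forall fun z => ?_)
  have harg : -(-ψ τ - (ψ z - ψ τ)) = ψ z := by ring
  simp only [abs_of_nonneg hmono.monotone.deriv_nonneg, smul_eq_mul, harg, hinvl z, mul_assoc]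

theorem contDiff_comp_inverse {ψ ψinv v : ℝ → ℝ} (hψ : ContDiff ℝ 1 ψ)
    (hψ' : ∀ t, deriv ψ t ≠ 0) (hinv : Continuous ψinv) (hinvr : Function.RightInverse ψinv ψ)
    (hv : ContDiff ℝ 1 v) : ContDiff ℝ 1 (v ∘ ψinv) := by
  have hd : ∀ s, HasDerivAt ψinv (deriv ψ (ψinv s))⁻¹ s := fun s =>
    HasDerivAt.of_local_left_inverse hinv.continuousAt
      (hψ.differentiable one_ne_zero _).hasDerivAt (hψ' _) (Eventually.of_forall hinvr)
  refine hv.comp (contDiff_one_iff_deriv.2 ⟨fun s => (hd s).differentiableAt, ?_⟩)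
  rw [show deriv ψinv = fun s => (deriv ψ (ψinv s))⁻¹ from funext fun s => (hd s).deriv]
  exact ((hψ.continuous_deriv le_rfl).comp hinv).inv₀ fun s => hψ' _

theorem rightRLDLine_eq_convolution {δ : ℝ} (hδ : δ < 1) {ψ ψinv v : ℝ → ℝ}
    (hψ : Differentiable ℝ ψ) (hmono : StrictMono ψ) (hinvl : Function.LeftInverse ψinv ψ)
    (hinvr : Function.RightInverse ψinv ψ) (hW : ContDiff ℝ 1 fun x => v (ψinv (-x)))
    (hWc : HasCompactSupport fun x => v (ψinv (-x))) {t : ℝ} (ht : deriv ψ t ≠ 0) :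
    rightRLDLine ψ δ v t = (Real.Gamma (1 - δ))⁻¹ *
      convolution (powKernel δ) (deriv fun x => v (ψinv (-x))) (ContinuousLinearMap.mul ℝ ℝ)
        volume (-ψ t) := by
  have hconv := hWc.hasDerivAt_convolution_right (ContinuousLinearMap.mul ℝ ℝ)
    (locallyIntegrable_powKernel hδ) hW (-ψ t)
  have hd := (hconv.comp t (hψ t).hasDerivAt.fun_neg).const_mul (1 / Real.Gamma (1 - δ))
  rw [rightRLDLine]
  simp_rw [setIntegral_psi_kernel_eq_convolution δ hψ hmono hinvl hinvr v]
  simp only [Function.comp_def] at hd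
  rw [hd.deriv]
  field_simp

theorem negIXiPow_eq_cpow {ξ : ℝ} (hξ : ξ ≠ 0) (μ : ℝ) :
    negIXiPow ξ μ = (Complex.I * ((-ξ : ℝ) : ℂ)) ^ (μ : ℂ) := by
  have hne : Complex.I * ((-ξ : ℝ) : ℂ) ≠ 0 := by simpa using hξ
  have hlog : Complex.log (Complex.I * ((-ξ : ℝ) : ℂ))
      = Real.log |ξ| - Complex.I * (Real.pi * Real.sign ξ / 2) := by
    rw [mul_comm Complex.I]
    rcases lt_or_gt_of_ne hξ with h | h
    · rw [Complex.log_ofReal_mul (neg_pos.2 h) Complex.I_ne_zero, Complex.log_I, abs_of_neg h,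
        Real.sign_of_neg h]
      push_cast
      ring
    · rw [Complex.ofReal_neg, neg_mul, ← mul_neg,
        Complex.log_ofReal_mul h (neg_ne_zero.2 Complex.I_ne_zero), Complex.log_neg_I,
        abs_of_pos h, Real.sign_of_pos h]
      push_cast
      ring
  rw [negIXiPow, Complex.cpow_def_of_ne_zero hne, hlog, Real.rpow_def_of_pos (abs_pos.2 hξ),
    Complex.ofReal_exp, ← Complex.exp_add]
  congr 1
  push_cast
  ring

theorem fourier_of_right_psi_fractional_derivative
    (δ : ℝ) (hδ0 : 0 < δ) (hδ1 : δ < 1)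
    (ψ ψinv : ℝ → ℝ) (hψ : ContDiff ℝ 1 ψ) (hmono : StrictMono ψ)
    (hbij : Function.Bijective ψ) (hψ' : ∀ t, 0 < deriv ψ t)
    (hinvl : Function.LeftInverse ψinv ψ) (hinvr : Function.RightInverse ψinv ψ)
    (v : ℝ → ℝ) (hv : ContDiff ℝ (⊤ : ℕ∞) v) (hsupp : HasCompactSupport v)
    (ξ : ℝ) (hξ : ξ ≠ 0) :
    fourierTransform (fun s => rightRLDLine ψ δ v (ψinv s)) ξ
      = negIXiPow ξ δ * fourierTransform (fun s => v (ψinv s)) ξ := by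
  have hψd : Differentiable ℝ ψ := hψ.differentiable one_ne_zero
  let e : ℝ ≃ₜ ℝ := (hmono.orderIsoOfSurjective ψ hbij.2).toHomeomorph
  have he : ψinv = e.symm := funext fun s => hbij.1 ((hinvr s).trans (e.apply_symm_apply s).symm)
  have hw : ContDiff ℝ 1 (v ∘ ψinv) :=
    contDiff_comp_inverse hψ (fun t => (hψ' t).ne') (he ▸ e.symm.continuous) hinvr
      (hv.of_le (by exact_mod_cast le_top))
  have hwc : HasCompactSupport (v ∘ ψinv) := he ▸ hsupp.comp_homeomorph e.symm
  have hW : ContDiff ℝ 1 fun x => v (ψinv (-x)) := hw.comp contDiff_neg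
  have hWc : HasCompactSupport fun x => v (ψinv (-x)) := hwc.comp_homeomorph (Homeomorph.neg ℝ)
  have hΓ : ((Real.Gamma (1 - δ) : ℝ) : ℂ) ≠ 0 :=
    Complex.ofReal_ne_zero.2 (Real.Gamma_pos_of_pos (by linarith)).ne'
  have hkey := fourier_convolution_powKernel_deriv hδ0 hδ1 hW hWc (neg_ne_zero.2 hξ)
  rw [← negIXiPow_eq_cpow hξ] at hkey
  have hfactor : ∀ s, rightRLDLine ψ δ v (ψinv s) = (Real.Gamma (1 - δ))⁻¹ *
      convolution (powKernel δ) (deriv fun x => v (ψinv (-x))) (ContinuousLinearMap.mul ℝ ℝ)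
        volume (-s) := fun s => by
    rw [rightRLDLine_eq_convolution hδ1 hψd hmono hinvl hinvr hW hWc (hψ' _).ne', hinvr s]
  have hreflect : ∀ g : ℝ → ℝ, fourierTransform g ξ
      = ∫ x : ℝ, ((g (-x) : ℝ) : ℂ) * Complex.exp (-(Complex.I * ((-ξ : ℝ) : ℂ) * x)) := by
    intro g
    rw [fourierTransform, ← integral_neg_eq_self]
    congr 1 with x
    congr 3
    push_cast
    ring
  rw [hreflect, hreflect]
  simp only [hfactor, neg_neg, Complex.ofReal_mul (Real.Gamma (1 - δ))⁻¹, mul_assoc]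
  rw [integral_const_mul]
  simp only [← mul_assoc, hkey]
  rw [Complex.ofReal_inv, inv_mul_cancel₀ hΓ, one_mul]
end

section
/- (Fourier transform of the left ψ-fractional integral; proven inside the proof of Lemma 2.1.) Define, for v ∈ C_c^∞(ℝ), the left ψ-fractional integral _{-∞}I^{δ,ψ}_t v(t) = (1/Γ(δ)) ∫_{-∞}^t ψ'(z)(ψ(t)-ψ(z))^{δ-1} v(z) dz. Then for every ξ ∈ ℝ with ξ ≠ 0, F((_{-∞}I^{δ,ψ}_t v)∘ψ^{-1})(ξ) = (iξ)^{-δ} · F(ṽ)(ξ), where the Fourier transform on the left is taken as an improper integral. -/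
open MeasureTheory Real Filter

/-- Left ψ-fractional integral on the whole line,
`(1/Γ(δ)) ∫_{-∞}^t ψ'(z)(ψ(t)-ψ(z))^{δ-1} v(z) dz`. -/
noncomputable def leftRLILine (ψ : ℝ → ℝ) (δ : ℝ) (v : ℝ → ℝ) (t : ℝ) : ℝ :=
  (1 / Real.Gamma δ) * ∫ z in Set.Iio t, deriv ψ z * (ψ t - ψ z) ^ (δ - 1) * v z

lemma integrableOn_rpow_mul_exp_neg_mul_Ioi {a r : ℝ} (ha : 0 < a) (hr : 0 < r) :
    IntegrableOn (fun x : ℝ => x ^ (a - 1) * Real.exp (-(r * x))) (Set.Ioi 0) := by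
  have := integrableOn_rpow_mul_exp_neg_mul_rpow (p := 1) (s := a - 1) (b := r)
    (by linarith) one_pos hr
  simpa using this

lemma integral_rpow_mul_cexp_neg_mul_Ioi_s2 {a : ℝ} {r : ℂ} (ha : 0 < a) (hr : 0 < r.re) :
    ∫ x in Set.Ioi (0 : ℝ), ((x ^ (a - 1) : ℝ) : ℂ) * Complex.exp (-(r * x)) =
      (1 / r) ^ (a : ℂ) * (Real.Gamma a : ℂ) := by
  set μ : Measure ℝ :=
    (volume.restrict (Set.Ioi 0)).withDensity (fun x => ENNReal.ofReal (x ^ (a - 1))) with hμ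
  have hmeas : Measurable (fun x : ℝ => ENNReal.ofReal (x ^ (a - 1))) := by fun_prop
  have hint (z : ℂ) : ∫ x in Set.Ioi (0 : ℝ), ((x ^ (a - 1) : ℝ) : ℂ) * Complex.exp (-(z * x)) =
      ProbabilityTheory.complexMGF id μ (-z) := by
    rw [ProbabilityTheory.complexMGF, hμ,
      integral_withDensity_eq_integral_toReal_smul hmeas (by simp)]
    refine setIntegral_congr_fun measurableSet_Ioi fun x hx => ?_
    have hx : (0 : ℝ) < x := hx
    simp [ENNReal.toReal_ofReal (rpow_nonneg hx.le _)]
  have hsub : Set.Iio 0 ⊆ ProbabilityTheory.integrableExpSet id μ := by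
    intro t ht
    have ht : t < 0 := ht
    rw [ProbabilityTheory.integrableExpSet, Set.mem_ofPred_eq, hμ,
      integrable_withDensity_iff_integrable_smul' hmeas (by simp)]
    refine (integrableOn_rpow_mul_exp_neg_mul_Ioi ha (neg_pos.2 ht)).congr_fun
      (fun x hx => ?_) measurableSet_Ioi
    have hx : (0 : ℝ) < x := hx
    simp [ENNReal.toReal_ofReal (rpow_nonneg hx.le _)]
  have hsub' := interior_maximal hsub isOpen_Iio
  have hU : IsOpen {z : ℂ | 0 < z.re} := isOpen_lt continuous_const Complex.continuous_re
  have hf : AnalyticOnNhd ℂ (fun z => ProbabilityTheory.complexMGF id μ (-z))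
      {z : ℂ | 0 < z.re} := by
    intro z hz
    have hz : 0 < z.re := hz
    refine (ProbabilityTheory.analyticAt_complexMGF (z := -z) (hsub' ?_)).comp analyticAt_id.neg
    simpa using hz
  have hg : AnalyticOnNhd ℂ (fun z : ℂ => (1 / z) ^ (a : ℂ) * (Real.Gamma a : ℂ))
      {z : ℂ | 0 < z.re} := by
    refine DifferentiableOn.analyticOnNhd (fun z hz => ?_) hU
    have hz : 0 < z.re := hz
    have hz0 : z ≠ 0 := by rintro rfl; simp at hz
    refine DifferentiableAt.differentiableWithinAt ?_
    refine DifferentiableAt.mul_const (DifferentiableAt.cpow ?_ (by fun_prop) ?_) _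
    · exact (differentiableAt_const _).div differentiableAt_id hz0
    · left
      rw [one_div, Complex.inv_re]
      exact div_pos hz (Complex.normSq_pos.2 hz0)
  have hpre : IsPreconnected {z : ℂ | 0 < z.re} := (convex_halfSpace_re_gt 0).isPreconnected
  rw [hint]
  refine hf.eqOn_of_preconnected_of_frequently_eq hg hpre (z₀ := 1) (by simp) ?_ hr
  have hlim : Tendsto (fun t : ℝ => (t : ℂ)) (nhdsWithin 1 {1}ᶜ) (nhdsWithin 1 {1}ᶜ) := by
    refine tendsto_nhdsWithin_of_tendsto_nhds_of_eventually_within _ ?_ ?_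
    · exact (Complex.continuous_ofReal.tendsto' 1 1 (by simp)).mono_left nhdsWithin_le_nhds
    · filter_upwards [self_mem_nhdsWithin] with t ht
      simpa using ht
  refine hlim.frequently (Eventually.frequently ?_)
  filter_upwards [nhdsWithin_le_nhds (lt_mem_nhds one_pos)] with t ht
  rw [← hint, ← Complex.Gamma_ofReal,
    ← Complex.integral_cpow_mul_exp_neg_mul_Ioi (by simpa using ha) ht]
  refine setIntegral_congr_fun measurableSet_Ioi fun x hx => ?_
  have hx : (0 : ℝ) < x := hx
  simp [Complex.ofReal_cpow hx.le]

lemma norm_integral_Ioi_rpow_mul_cexp_le {a T : ℝ} {r : ℂ} (ha : 0 < a) (ha1 : a < 1)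
    (hr : 0 < r.re) (hT : 0 < T) :
    ‖∫ x in Set.Ioi T, ((x ^ (a - 1) : ℝ) : ℂ) * Complex.exp (-(r * x))‖ ≤
      2 * T ^ (a - 1) / ‖r‖ := by
  have hr0 : r ≠ 0 := by rintro rfl; simp at hr
  have hnr : 0 < ‖r‖ := norm_pos_iff.2 hr0
  have hexp (x : ℝ) (hx : 0 < x) : ‖Complex.exp (-(r * x))‖ ≤ 1 := by
    rw [Complex.norm_exp, Real.exp_le_one_iff]
    simpa using mul_nonneg hr.le hx.le
  have hpos (x : ℝ) (hx : x ∈ Set.Ioi T) : 0 < x := hT.trans hx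
  have hi1 : IntegrableOn (fun x : ℝ => ((x ^ (a - 1) : ℝ) : ℂ) * Complex.exp (-(r * x)))
      (Set.Ioi T) := by
    refine Integrable.mono' ((integrableOn_rpow_mul_exp_neg_mul_Ioi ha hr).mono_set
      (Set.Ioi_subset_Ioi hT.le)) (Measurable.aestronglyMeasurable (by fun_prop)) ?_
    filter_upwards [ae_restrict_mem measurableSet_Ioi] with x hx
    rw [norm_mul, Complex.norm_real, Complex.norm_exp,
      Real.norm_of_nonneg (rpow_nonneg (hpos x hx).le _)]
    simp
  have hdom := (integrableOn_Ioi_rpow_of_lt (show a - 2 < -1 by linarith) hT)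
  have hbd : ∀ᵐ x ∂(volume.restrict (Set.Ioi T)),
      ‖((x ^ (a - 2) : ℝ) : ℂ) * Complex.exp (-(r * x))‖ ≤ x ^ (a - 2) := by
    filter_upwards [ae_restrict_mem measurableSet_Ioi] with x hx
    rw [norm_mul, Complex.norm_real, Real.norm_of_nonneg (rpow_nonneg (hpos x hx).le _)]
    exact mul_le_of_le_one_right (rpow_nonneg (hpos x hx).le _) (hexp x (hpos x hx))
  have hi2 : IntegrableOn (fun x : ℝ => ((x ^ (a - 2) : ℝ) : ℂ) * Complex.exp (-(r * x)))
      (Set.Ioi T) :=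
    Integrable.mono' hdom (Measurable.aestronglyMeasurable (by fun_prop)) hbd
  have hder (x : ℝ) (hx : 0 < x) :
      HasDerivAt (fun x : ℝ => ((x ^ (a - 1) : ℝ) : ℂ) * Complex.exp (-(r * x)))
      (((a - 1 : ℝ) : ℂ) * (((x ^ (a - 2) : ℝ) : ℂ) * Complex.exp (-(r * x))) -
        r * (((x ^ (a - 1) : ℝ) : ℂ) * Complex.exp (-(r * x)))) x := by
    have h1 := ((hasDerivAt_id x).rpow_const (p := a - 1) (Or.inl hx.ne')).ofReal_comp
    have h2 : HasDerivAt (fun x : ℝ => -(r * (x : ℂ))) (-(r * 1)) x :=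
      ((Complex.ofRealCLM.hasDerivAt (x := x)).const_mul r).neg
    convert! h1.mul h2.cexp using 1
    simp only [id, show a - 1 - 1 = a - 2 by ring]
    push_cast
    ring
  have hlim : Tendsto (fun x : ℝ => ((x ^ (a - 1) : ℝ) : ℂ) * Complex.exp (-(r * x)))
      atTop (nhds 0) := by
    have h0 := tendsto_rpow_neg_atTop (show 0 < 1 - a by linarith)
    refine squeeze_zero_norm' ?_ h0
    filter_upwards [eventually_gt_atTop 0] with x hx
    rw [norm_mul, Complex.norm_real, Real.norm_of_nonneg (rpow_nonneg hx.le _), neg_sub]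
    exact mul_le_of_le_one_right (rpow_nonneg hx.le _) (hexp x hx)
  have key := integral_Ioi_of_hasDerivAt_of_tendsto (a := T)
    (hder T hT).continuousAt.continuousWithinAt (fun x hx => hder x (hpos x hx))
    ((hi2.const_mul _).sub (hi1.const_mul r)) hlim
  rw [integral_sub (hi2.const_mul _) (hi1.const_mul r), integral_const_mul,
    integral_const_mul] at key
  have hI2 := norm_integral_le_of_norm_le hdom hbd
  rw [integral_Ioi_rpow_of_lt (by linarith) hT, show a - 2 + 1 = a - 1 by ring] at hI2
  set I1 := ∫ x in Set.Ioi T, ((x ^ (a - 1) : ℝ) : ℂ) * Complex.exp (-(r * x))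
  set I2 := ∫ x in Set.Ioi T, ((x ^ (a - 2) : ℝ) : ℂ) * Complex.exp (-(r * x))
  have hTn := rpow_nonneg hT.le (a - 1)
  rw [le_div_iff₀ hnr, mul_comm, ← norm_mul,
    show r * I1 = ((a - 1 : ℝ) : ℂ) * I2 +
      ((T ^ (a - 1) : ℝ) : ℂ) * Complex.exp (-(r * T)) by linear_combination -key]
  refine (norm_add_le _ _).trans ?_
  rw [norm_mul, norm_mul, Complex.norm_real, Complex.norm_real, Real.norm_of_nonneg hTn,
    Real.norm_of_nonpos (by linarith)]
  have h1 : -(a - 1) * ‖I2‖ ≤ T ^ (a - 1) := by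
    calc -(a - 1) * ‖I2‖ ≤ -(a - 1) * (-T ^ (a - 1) / (a - 1)) :=
          mul_le_mul_of_nonneg_left hI2 (by linarith)
      _ = T ^ (a - 1) := by
          have : a - 1 ≠ 0 := by linarith
          field_simp
  have h2 := mul_le_of_le_one_right hTn (hexp T hT)
  linarith

lemma norm_integral_Ioc_rpow_mul_cexp_sub_le {a T : ℝ} {r : ℂ} (ha : 0 < a) (ha1 : a < 1)
    (hr : 0 < r.re) (hT : 0 < T) :
    ‖(∫ x in Set.Ioc 0 T, ((x ^ (a - 1) : ℝ) : ℂ) * Complex.exp (-(r * x))) -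
      (1 / r) ^ (a : ℂ) * (Real.Gamma a : ℂ)‖ ≤ 2 * T ^ (a - 1) / ‖r‖ := by
  have hi : IntegrableOn (fun x : ℝ => ((x ^ (a - 1) : ℝ) : ℂ) * Complex.exp (-(r * x)))
      (Set.Ioi 0) := by
    refine Integrable.mono' (integrableOn_rpow_mul_exp_neg_mul_Ioi ha hr)
      (Measurable.aestronglyMeasurable (by fun_prop)) ?_
    filter_upwards [ae_restrict_mem measurableSet_Ioi] with x hx
    have hx : (0 : ℝ) < x := hx
    rw [norm_mul, Complex.norm_real, Complex.norm_exp, Real.norm_of_nonneg (rpow_nonneg hx.le _)]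
    simp
  rw [← integral_rpow_mul_cexp_neg_mul_Ioi_s2 ha hr, ← Set.Ioc_union_Ioi_eq_Ioi hT.le,
    setIntegral_union Set.Ioc_disjoint_Ioi_same measurableSet_Ioi
      (hi.mono_set Set.Ioc_subset_Ioi_self) (hi.mono_set (Set.Ioi_subset_Ioi hT.le)),
    sub_add_cancel_left, norm_neg]
  exact norm_integral_Ioi_rpow_mul_cexp_le ha ha1 hr hT

lemma integrableOn_rpow_Ioc {a : ℝ} (ha : 0 < a) (T : ℝ) :
    IntegrableOn (fun x : ℝ => x ^ (a - 1)) (Set.Ioc 0 T) :=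
  (intervalIntegral.intervalIntegrable_rpow' (a := 0) (b := T) (by linarith)).1

lemma norm_integral_Ioc_rpow_mul_cexp_I_sub_le {a T ξ : ℝ} (ha : 0 < a) (ha1 : a < 1)
    (hξ : ξ ≠ 0) (hT : 0 < T) :
    ‖(∫ x in Set.Ioc 0 T, ((x ^ (a - 1) : ℝ) : ℂ) * Complex.exp (-(Complex.I * ξ * x))) -
      (1 / (Complex.I * ξ)) ^ (a : ℂ) * (Real.Gamma a : ℂ)‖ ≤ 2 * T ^ (a - 1) / |ξ| := by
  have hr0 : Complex.I * (ξ : ℂ) ≠ 0 := by simp [hξ]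
  have hr : Tendsto (fun ε : ℝ => (ε : ℂ) + Complex.I * ξ) (nhdsWithin 0 (Set.Ioi 0))
      (nhds (Complex.I * ξ)) := by
    have : Continuous (fun ε : ℝ => (ε : ℂ) + Complex.I * ξ) := by fun_prop
    exact (this.tendsto' 0 _ (by simp)).mono_left nhdsWithin_le_nhds
  have h1 : Tendsto (fun ε : ℝ => ∫ x in Set.Ioc 0 T, ((x ^ (a - 1) : ℝ) : ℂ) *
      Complex.exp (-(((ε : ℂ) + Complex.I * ξ) * x))) (nhdsWithin 0 (Set.Ioi 0))
      (nhds (∫ x in Set.Ioc 0 T, ((x ^ (a - 1) : ℝ) : ℂ) *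
        Complex.exp (-(Complex.I * ξ * x)))) := by
    refine tendsto_integral_filter_of_dominated_convergence (fun x => x ^ (a - 1)) ?_ ?_
      (integrableOn_rpow_Ioc ha T) ?_
    · exact Eventually.of_forall fun ε => Measurable.aestronglyMeasurable (by fun_prop)
    · filter_upwards [self_mem_nhdsWithin] with ε hε
      filter_upwards [ae_restrict_mem measurableSet_Ioc] with x hx
      have hε : 0 < ε := hε
      rw [norm_mul, Complex.norm_real, Real.norm_of_nonneg (rpow_nonneg hx.1.le _)]
      refine mul_le_of_le_one_right (rpow_nonneg hx.1.le _) ?_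
      rw [Complex.norm_exp, Real.exp_le_one_iff]
      simpa using mul_nonneg hε.le hx.1.le
    · refine Eventually.of_forall fun x => ?_
      have hc : Continuous fun r : ℂ => ((x ^ (a - 1) : ℝ) : ℂ) * Complex.exp (-(r * x)) := by
        fun_prop
      exact (hc.tendsto _).comp hr
  have hslit : 1 / (Complex.I * (ξ : ℂ)) ∈ Complex.slitPlane := by
    right
    simp [Complex.inv_im, hξ]
  have h2 := ((((continuousAt_const (y := (1 : ℂ))).div continuousAt_id hr0).cpow
    (continuousAt_const (y := (a : ℂ))) hslit).tendsto.comp hr).mul_const (Real.Gamma a : ℂ)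
  have h3 := (h1.sub h2).norm
  have h4 : Tendsto (fun ε : ℝ => 2 * T ^ (a - 1) / ‖(ε : ℂ) + Complex.I * ξ‖)
      (nhdsWithin 0 (Set.Ioi 0)) (nhds (2 * T ^ (a - 1) / ‖Complex.I * (ξ : ℂ)‖)) :=
    tendsto_const_nhds.div hr.norm (norm_ne_zero_iff.2 hr0)
  rw [show |ξ| = ‖Complex.I * (ξ : ℂ)‖ by simp]
  refine le_of_tendsto_of_tendsto h3 h4 ?_
  filter_upwards [self_mem_nhdsWithin] with ε hε
  exact norm_integral_Ioc_rpow_mul_cexp_sub_le ha ha1 (by simpa using hε) hT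

lemma one_div_I_mul_cpow {a ξ : ℝ} (hξ : ξ ≠ 0) :
    (1 / (Complex.I * ξ)) ^ (a : ℂ) = iXiPow ξ (-a) := by
  have habs : 0 < |ξ| := abs_pos.2 hξ
  have hexp : 1 / (Complex.I * (ξ : ℂ)) =
      Complex.exp (((-Real.log |ξ| : ℝ) : ℂ) + ((-(Real.pi * Real.sign ξ / 2) : ℝ) : ℂ) *
        Complex.I) := by
    rw [Complex.exp_add, ← Complex.ofReal_exp, Real.exp_neg, Real.exp_log habs,
      Complex.exp_mul_I, ← Complex.ofReal_cos, ← Complex.ofReal_sin]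
    rcases lt_or_gt_of_ne hξ with h | h
    · rw [Real.sign_of_neg h, abs_of_neg h]
      simp [neg_div]
    · rw [Real.sign_of_pos h, abs_of_pos h]
      simp
  have him : (((-Real.log |ξ| : ℝ) : ℂ) + ((-(Real.pi * Real.sign ξ / 2) : ℝ) : ℂ) *
      Complex.I).im = -(Real.pi * Real.sign ξ / 2) := by simp
  have hne : 1 / (Complex.I * (ξ : ℂ)) ≠ 0 := by simp [hξ]
  have hs : |Real.sign ξ| = 1 := by
    rcases lt_or_gt_of_ne hξ with h | h
    · simp [Real.sign_of_neg h]
    · simp [Real.sign_of_pos h]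
  have hs1 := abs_le.1 hs.le
  rw [Complex.cpow_def_of_ne_zero hne, hexp, Complex.log_exp
    (by rw [him]; nlinarith [Real.pi_pos]) (by rw [him]; nlinarith [Real.pi_pos]), iXiPow,
    Real.rpow_def_of_pos habs, Complex.ofReal_exp, ← Complex.exp_add]
  congr 1
  push_cast
  ring

/-- Substituting `u = ψ z` turns the ψ-fractional integral into the classical one. -/
lemma leftRLILine_eq_integral_Iio {ψ ψinv : ℝ → ℝ} (δ : ℝ) (hψ : Differentiable ℝ ψ)
    (hmono : StrictMono ψ) (hψ' : ∀ t, 0 < deriv ψ t) (hinvl : Function.LeftInverse ψinv ψ)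
    (hinvr : Function.RightInverse ψinv ψ) (v : ℝ → ℝ) (s : ℝ) :
    leftRLILine ψ δ v (ψinv s) =
      (1 / Real.Gamma δ) * ∫ u in Set.Iio s, (s - u) ^ (δ - 1) * v (ψinv u) := by
  have himg : ψ '' Set.Iio (ψinv s) = Set.Iio s := by
    ext u
    constructor
    · rintro ⟨z, hz, rfl⟩
      have := hmono (Set.mem_Iio.1 hz)
      rwa [hinvr s] at this
    · intro hu
      refine ⟨ψinv u, ?_, hinvr u⟩
      rw [Set.mem_Iio, ← hmono.lt_iff_lt, hinvr, hinvr]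
      exact hu
  rw [leftRLILine, ← himg, integral_image_eq_integral_abs_deriv_smul measurableSet_Iio
    (fun x _ => (hψ x).hasDerivAt.hasDerivWithinAt) hmono.injective.injOn]
  simp only [abs_of_pos (hψ' _), hinvr s, hinvl _, smul_eq_mul, mul_assoc]

/-- The truncated Fourier integral of a fractional integral, with the order of integration
exchanged. -/
lemma intervalIntegral_fractional_mul_cexp {a M R ξ : ℝ} (ha : 0 < a) {w : ℝ → ℝ}
    (hw : Continuous w) (hM : ∀ u, w u ≠ 0 → |u| ≤ M) (hMR : M ≤ R) :
    ∫ s in (-R)..R, ((∫ u in Set.Iio s, (s - u) ^ (a - 1) * w u : ℝ) : ℂ) *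
        Complex.exp (-(Complex.I * ξ * s)) =
      ∫ u, (w u : ℂ) * Complex.exp (-(Complex.I * ξ * u)) *
        ∫ x in Set.Ioc 0 (R - u), ((x ^ (a - 1) : ℝ) : ℂ) * Complex.exp (-(Complex.I * ξ * x)) := by
  set k : ℝ → ℝ := (Set.Ioc 0 (R + M)).indicator (fun x => x ^ (a - 1)) with hk
  have hkint : Integrable k :=
    (integrable_indicator_iff measurableSet_Ioc).2 (integrableOn_rpow_Ioc ha _)
  have hwint : Integrable w := by
    refine hw.integrable_of_hasCompactSupport (HasCompactSupport.intro' (K := Set.Icc (-M) M)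
      isCompact_Icc isClosed_Icc fun u hu => ?_)
    by_contra h
    exact hu (abs_le.1 (hM u h))
  have hinner (s : ℝ) (hs : s ≤ R) :
      ∫ u in Set.Iio s, (s - u) ^ (a - 1) * w u = ∫ u, w u * k (s - u) := by
    rw [← integral_indicator measurableSet_Iio]
    refine integral_congr_ae (Eventually.of_forall fun u => ?_)
    simp only [hk, Set.indicator_apply, Set.mem_Iio, Set.mem_Ioc, sub_pos]
    by_cases hu : w u = 0
    · simp [hu]
    · have := (abs_le.1 (hM u hu)).1
      have h2 : s - u ≤ R + M := by linarith
      simp [h2, mul_comm]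
  have hR : -R ≤ R ∨ M < 0 := by
    by_cases h : M < 0
    · exact Or.inr h
    · left; linarith
  rcases hR with hR | hneg
  swap
  · have hw0 (u : ℝ) : w u = 0 := by
      by_contra h
      linarith [hM u h, abs_nonneg u]
    simp [hw0]
  have hexp (x : ℝ) : ‖Complex.exp (-(Complex.I * ξ * x))‖ = 1 := by
    rw [Complex.norm_exp]
    simp
  have hconv := (hwint.ofReal (𝕜 := ℂ)).convolution_integrand (ContinuousLinearMap.mul ℝ ℂ)
    (hkint.ofReal (𝕜 := ℂ))
  have hconv' : Integrable (Function.uncurry fun s u : ℝ => Complex.exp (-(Complex.I * ξ * s)) *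
      ((w u : ℂ) * (k (s - u) : ℂ))) ((volume.restrict (Set.Ioc (-R) R)).prod volume) := by
    refine Integrable.bdd_mul (c := 1) (hconv.mono_measure
      (Measure.prod_mono Measure.restrict_le_self le_rfl)) ?_ ?_
    · exact Measurable.aestronglyMeasurable (by fun_prop)
    · exact Eventually.of_forall fun p => (hexp p.1).le
  have hlhs : ∫ s in (-R)..R, ((∫ u in Set.Iio s, (s - u) ^ (a - 1) * w u : ℝ) : ℂ) *
      Complex.exp (-(Complex.I * ξ * s)) = ∫ s in Set.Ioc (-R) R, ∫ u,
        Complex.exp (-(Complex.I * ξ * s)) * ((w u : ℂ) * (k (s - u) : ℂ)) := by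
    rw [intervalIntegral.integral_of_le hR]
    refine setIntegral_congr_fun measurableSet_Ioc fun s hs => ?_
    rw [hinner s hs.2, integral_const_mul, mul_comm, ← integral_complex_ofReal]
    simp
  rw [hlhs, integral_integral_swap hconv']
  refine integral_congr_ae (Eventually.of_forall fun u => ?_)
  simp only
  by_cases hu : w u = 0
  · simp [hu]
  have hu' := abs_le.1 (hM u hu)
  rw [← intervalIntegral.integral_of_le hR]
  have hsplit (s : ℝ) : Complex.exp (-(Complex.I * ξ * s)) * ((w u : ℂ) * (k (s - u) : ℂ)) =
      (w u : ℂ) * Complex.exp (-(Complex.I * ξ * u)) *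
        ((k (s - u) : ℂ) * Complex.exp (-(Complex.I * ξ * ((s - u : ℝ) : ℂ)))) := by
    rw [show -(Complex.I * (ξ : ℂ) * s) =
      -(Complex.I * ξ * u) + -(Complex.I * ξ * ((s - u : ℝ) : ℂ)) by push_cast; ring,
      Complex.exp_add]
    ring
  simp_rw [hsplit]
  rw [intervalIntegral.integral_const_mul, intervalIntegral.integral_comp_sub_right
    (fun x : ℝ => (k x : ℂ) * Complex.exp (-(Complex.I * ξ * (x : ℂ)))) u,
    intervalIntegral.integral_of_le (by linarith)]
  congr 1
  have hset : Set.Ioc 0 (R - u) = Set.Ioc (-R - u) (R - u) ∩ Set.Ioc 0 (R + M) := by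
    rw [Set.Ioc_inter_Ioc, max_eq_right (by linarith), min_eq_left (by linarith)]
  rw [hset, ← setIntegral_indicator measurableSet_Ioc]
  refine integral_congr_ae (Eventually.of_forall fun x => ?_)
  by_cases hx : x ∈ Set.Ioc 0 (R + M) <;> simp [hk, hx]

/-- The Fourier transform of `(_{-∞}I^{δ,ψ}_t v) ∘ ψ⁻¹`, taken as an improper integral
`lim_{R→∞} ∫_{-R}^R (...) e^{-iξs} ds`, equals `(iξ)^{-δ} F(ṽ)(ξ)`. -/
theorem fourier_of_left_psi_fractional_integral
    (δ : ℝ) (hδ0 : 0 < δ) (hδ1 : δ < 1)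
    (ψ ψinv : ℝ → ℝ) (hψ : ContDiff ℝ 1 ψ) (hmono : StrictMono ψ)
    (hbij : Function.Bijective ψ) (hψ' : ∀ t, 0 < deriv ψ t)
    (hinvl : Function.LeftInverse ψinv ψ) (hinvr : Function.RightInverse ψinv ψ)
    (v : ℝ → ℝ) (hv : ContDiff ℝ (⊤ : ℕ∞) v) (hsupp : HasCompactSupport v)
    (ξ : ℝ) (hξ : ξ ≠ 0) :
    Tendsto
      (fun R : ℝ => ∫ s in (-R)..R,
        ((leftRLILine ψ δ v (ψinv s) : ℝ) : ℂ) * Complex.exp (-(Complex.I * ξ * s)))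
      atTop
      (nhds (iXiPow ξ (-δ) * fourierTransform (fun s => v (ψinv s)) ξ)) := by
  have hinvmono : Monotone ψinv := fun x y hxy => by
    rw [← hmono.le_iff_le, hinvr, hinvr]
    exact hxy
  have hinvc : Continuous ψinv := hinvmono.continuous_of_surjective hinvl.surjective
  have hw : Continuous fun s => v (ψinv s) := hv.continuous.comp hinvc
  obtain ⟨M, hM⟩ : ∃ M : ℝ, ∀ u, v (ψinv u) ≠ 0 → |u| ≤ M := by
    obtain ⟨M, hM⟩ := (hsupp.isCompact.image hψ.continuous).isBounded.exists_norm_le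
    exact ⟨M, fun u hu => hM u ⟨ψinv u, subset_tsupport _ hu, hinvr u⟩⟩
  have hwint : Integrable fun u => v (ψinv u) :=
    hw.integrable_of_hasCompactSupport (HasCompactSupport.intro' (K := Set.Icc (-M) M)
      isCompact_Icc isClosed_Icc fun u hu => by
        by_contra h
        exact hu (abs_le.1 (hM u h)))
  have hΓ : (Real.Gamma δ : ℂ) ≠ 0 := by exact_mod_cast (Real.Gamma_pos_of_pos hδ0).ne'
  set L : ℂ := iXiPow ξ (-δ) * (Real.Gamma δ : ℂ) with hL
  set K : ℝ → ℂ := fun T =>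
    ∫ x in Set.Ioc 0 T, ((x ^ (δ - 1) : ℝ) : ℂ) * Complex.exp (-(Complex.I * ξ * x)) with hKdef
  have hexp (x : ℝ) : ‖Complex.exp (-(Complex.I * ξ * x))‖ = 1 := by
    rw [Complex.norm_exp]
    simp
  have hK : Tendsto K atTop (nhds L) := by
    rw [tendsto_iff_norm_sub_tendsto_zero]
    have h0 := ((tendsto_rpow_neg_atTop (show 0 < 1 - δ by linarith)).const_mul 2).div_const |ξ|
    rw [mul_zero, zero_div] at h0
    refine squeeze_zero' (Eventually.of_forall fun _ => norm_nonneg _) ?_ h0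
    filter_upwards [eventually_gt_atTop 0] with T hT
    rw [hL, ← one_div_I_mul_cpow hξ, neg_sub]
    exact norm_integral_Ioc_rpow_mul_cexp_I_sub_le hδ0 hδ1 hξ hT
  have hKmeas : Continuous K := by
    have hint (c d : ℝ) : IntervalIntegrable (fun x : ℝ => ((x ^ (δ - 1) : ℝ) : ℂ) *
        Complex.exp (-(Complex.I * ξ * x))) volume c d :=
      IntervalIntegrable.mul_continuousOn
        ⟨(intervalIntegral.intervalIntegrable_rpow' (by linarith)).1.ofReal,
          (intervalIntegral.intervalIntegrable_rpow' (by linarith)).2.ofReal⟩ (by fun_prop)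
    have hc := intervalIntegral.continuous_primitive hint 0
    have : K = fun T => ∫ x in (0 : ℝ)..(max T 0), ((x ^ (δ - 1) : ℝ) : ℂ) *
        Complex.exp (-(Complex.I * ξ * x)) := by
      funext T
      rw [intervalIntegral.integral_of_le (le_max_right _ _)]
      rcases le_total T 0 with h | h
      · simp [hKdef, h]
      · simp [hKdef, h]
    rw [this]
    exact hc.comp (by fun_prop)
  have hbound : ∀ᶠ T in atTop, ‖K T‖ ≤ ‖L‖ + 1 :=
    hK.norm.eventually_le_const (by linarith)
  obtain ⟨T₀, hT₀⟩ := eventually_atTop.1 hbound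
  have hlim : Tendsto (fun R : ℝ => ∫ u, (v (ψinv u) : ℂ) * Complex.exp (-(Complex.I * ξ * u)) *
      K (R - u)) atTop
      (nhds (∫ u, (v (ψinv u) : ℂ) * Complex.exp (-(Complex.I * ξ * u)) * L)) := by
    refine tendsto_integral_filter_of_dominated_convergence
      (fun u => ‖v (ψinv u)‖ * (‖L‖ + 1)) ?_ ?_ (hwint.norm.mul_const _) ?_
    · exact Eventually.of_forall fun R => Continuous.aestronglyMeasurable (by fun_prop)
    · filter_upwards [eventually_ge_atTop (T₀ + M)] with R hR
      refine Eventually.of_forall fun u => ?_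
      rw [norm_mul, norm_mul, hexp, mul_one, Complex.norm_real]
      by_cases hu : v (ψinv u) = 0
      · simp [hu]
      · have := (abs_le.1 (hM u hu)).2
        exact mul_le_mul_of_nonneg_left (hT₀ _ (by linarith)) (norm_nonneg _)
    · refine Eventually.of_forall fun u => Tendsto.const_mul _ (hK.comp ?_)
      exact tendsto_atTop_add_const_right _ (-u) tendsto_id
  have hlim' := hlim.const_mul (1 / (Real.Gamma δ : ℂ))
  rw [integral_mul_const, hL] at hlim'
  rw [fourierTransform]
  convert! hlim'.congr' ?_ using 2
  · field_simp
  · filter_upwards [eventually_ge_atTop M] with R hR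
    rw [← intervalIntegral_fractional_mul_cexp hδ0 hw hM hR,
      ← intervalIntegral.integral_const_mul]
    refine intervalIntegral.integral_congr fun s _ => ?_
    rw [leftRLILine_eq_integral_Iio δ (hψ.differentiable one_ne_zero) hmono hψ' hinvl hinvr]
    push_cast
    ring
end

section
/- (Equation (2.14) in Step 3 of Lemma 2.2: cosine identity for the mixed ψ-fractional pairing on ℝ.) For every v ∈ C_c^∞(ℝ), ∫_ℝ (_{-∞}D^{δ,ψ}_t v)(t) · (_tD^{δ,ψ}_{+∞} v)(t) · ψ'(t) dt = cos(πδ) · ∫_ℝ |(_{-∞}D^{δ,ψ}_t v)(t)|² ψ'(t) dt. -/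
open MeasureTheory Real

theorem integrableOn_beta_integrand {a b : ℝ} (ha : 0 < a) (hb : 0 < b) :
    IntegrableOn (fun x : ℝ => x ^ (a - 1) * (1 - x) ^ (b - 1)) (Set.Ioo 0 1) ∧
    ∫ x in Set.Ioo (0 : ℝ) 1, x ^ (a - 1) * (1 - x) ^ (b - 1) = ProbabilityTheory.beta a b := by
  have h1 := Complex.betaIntegral_convergent (u := a) (v := b) (by simpa) (by simpa)
  rw [intervalIntegrable_iff_integrableOn_Ioo_of_le zero_le_one] at h1
  have heq : Set.EqOn (fun x : ℝ => ((x : ℂ) ^ ((a : ℂ) - 1) * (1 - (x : ℂ)) ^ ((b : ℂ) - 1)).re)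
      (fun x : ℝ => x ^ (a - 1) * (1 - x) ^ (b - 1)) (Set.Ioo 0 1) := by
    intro x hx
    dsimp only
    rw [← Complex.ofReal_one, ← Complex.ofReal_sub, ← Complex.ofReal_sub, ← Complex.ofReal_sub,
      ← Complex.ofReal_cpow hx.1.le, ← Complex.ofReal_cpow (by linarith [hx.2]),
      ← Complex.ofReal_mul, Complex.ofReal_re]
  refine ⟨IntegrableOn.congr_fun h1.re heq measurableSet_Ioo, ?_⟩
  rw [ProbabilityTheory.beta_eq_betaIntegralReal a b ha hb, Complex.betaIntegral,
    intervalIntegral.integral_of_le zero_le_one, integral_Ioc_eq_integral_Ioo,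
    ← setIntegral_congr_fun measurableSet_Ioo heq]
  exact integral_re h1

theorem integral_Ioo_sub_rpow_mul_sub_rpow {a b δ : ℝ} (hab : a < b) (hδ : δ < 1) :
    ∫ s in Set.Ioo a b, (s - a) ^ (-δ) * (b - s) ^ (-δ) =
      (b - a) ^ (1 - 2 * δ) * ProbabilityTheory.beta (1 - δ) (1 - δ) := by
  have hc : 0 < b - a := by linarith
  have himg : (fun x => (b - a) * x + a) '' Set.Ioo 0 1 = Set.Ioo a b := by
    rw [Set.image_affine_Ioo hc]; simp
  rw [← himg, integral_image_eq_integral_abs_deriv_smul (f' := fun _ => b - a) measurableSet_Ioo,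
    ← (integrableOn_beta_integrand (a := 1 - δ) (b := 1 - δ) (by linarith) (by linarith)).2,
    ← integral_const_mul]
  · refine setIntegral_congr_fun measurableSet_Ioo fun x hx => ?_
    have hx1 : 0 < 1 - x := by linarith [hx.2]
    have e1 : (b - a) * x + a - a = (b - a) * x := by ring
    have e2 : b - ((b - a) * x + a) = (b - a) * (1 - x) := by ring
    have e3 : (b - a) ^ (1 - 2 * δ) = (b - a) * ((b - a) ^ (-δ) * (b - a) ^ (-δ)) := by
      rw [← rpow_add hc, show 1 - 2 * δ = 1 + (-δ + -δ) by ring, rpow_add hc 1, rpow_one]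
    have e4 : 1 - δ - 1 = -δ := by ring
    simp only [smul_eq_mul, e1, e2, e3, e4, abs_of_pos hc]
    rw [mul_rpow hc.le hx.1.le, mul_rpow hc.le hx1.le]
    ring
  · intro x _
    exact (((hasDerivAt_id x).const_mul (b - a)).add_const a).hasDerivWithinAt.congr_deriv (by simp)
  · intro x _ y _ h
    simpa [hc.ne'] using h

theorem integrableOn_Ioi_rpow_mul_add_rpow {a b c : ℝ} (ha : 0 < a) (hb : 0 < b) (hc : 0 < c) :
    IntegrableOn (fun u : ℝ => u ^ (a - 1) * (u + c) ^ (-(a + b))) (Set.Ioi 0) ∧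
    ∫ u in Set.Ioi (0 : ℝ), u ^ (a - 1) * (u + c) ^ (-(a + b)) =
      c ^ (-b) * ProbabilityTheory.beta a b := by
  have himg : (fun x : ℝ => c * x / (1 - x)) '' Set.Ioo 0 1 = Set.Ioi 0 := by
    ext u
    simp only [Set.mem_image, Set.mem_Ioo, Set.mem_Ioi]
    constructor
    · rintro ⟨x, ⟨h0, h1⟩, rfl⟩
      have : 0 < 1 - x := by linarith
      positivity
    · intro hu
      refine ⟨u / (u + c), ⟨by positivity, by rw [div_lt_one (by positivity)]; linarith⟩, ?_⟩
      have : 1 - u / (u + c) = c / (u + c) := by field_simp; ring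
      rw [this]
      field_simp
  have hder : ∀ x ∈ Set.Ioo (0 : ℝ) 1,
      HasDerivWithinAt (fun x : ℝ => c * x / (1 - x)) (c / (1 - x) ^ 2) (Set.Ioo 0 1) x := by
    intro x hx
    have hx1 : 1 - x ≠ 0 := by linarith [hx.2]
    have h := (((hasDerivAt_id x).const_mul c).div ((hasDerivAt_id x).const_sub 1) hx1)
    refine h.hasDerivWithinAt.congr_deriv ?_
    simp only [id]
    congr 1
    ring
  have hinj : Set.InjOn (fun x : ℝ => c * x / (1 - x)) (Set.Ioo 0 1) := by
    intro x hx y hy h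
    have hx1 : 1 - x ≠ 0 := by linarith [hx.2]
    have hy1 : 1 - y ≠ 0 := by linarith [hy.2]
    simp only at h
    rw [div_eq_div_iff hx1 hy1] at h
    have : c * (x - y) = 0 := by linarith
    rcases mul_eq_zero.1 this with h | h
    · exact absurd h hc.ne'
    · linarith
  have heq : Set.EqOn (fun x : ℝ => c ^ (-b) * (x ^ (a - 1) * (1 - x) ^ (b - 1)))
      (fun x => |c / (1 - x) ^ 2| •
        ((c * x / (1 - x)) ^ (a - 1) * (c * x / (1 - x) + c) ^ (-(a + b)))) (Set.Ioo 0 1) := by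
    intro x hx
    have hx0 := hx.1
    have hx1 : 0 < 1 - x := by linarith [hx.2]
    have e1 : c * x / (1 - x) + c = c / (1 - x) := by field_simp; ring
    have e2 : (1 - x) ^ (b - 1) = (1 - x) ^ (a + b) / ((1 - x) ^ (a - 1) * (1 - x) ^ 2) := by
      rw [eq_div_iff (by positivity), ← rpow_natCast, ← rpow_add hx1, ← rpow_add hx1]
      congr 1; push_cast; ring
    have e3 : c ^ (-b) = c * c ^ (a - 1) / c ^ (a + b) := by
      rw [eq_div_iff (by positivity), ← rpow_add hc]
      nth_rewrite 2 [← rpow_one c]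
      rw [← rpow_add hc]
      congr 1; ring
    simp only [smul_eq_mul]
    rw [abs_of_pos (by positivity), e1, e2, e3, div_rpow (by positivity) hx1.le,
      div_rpow hc.le hx1.le, mul_rpow hc.le hx0.le, rpow_neg hc.le, rpow_neg hx1.le]
    field_simp
  have hbeta := integrableOn_beta_integrand ha hb
  constructor
  · rw [← himg, integrableOn_image_iff_integrableOn_abs_deriv_smul measurableSet_Ioo hder hinj]
    exact IntegrableOn.congr_fun (hbeta.1.const_mul (c ^ (-b))) heq measurableSet_Ioo
  · rw [← himg, integral_image_eq_integral_abs_deriv_smul measurableSet_Ioo hder hinj,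
      ← hbeta.2, ← integral_const_mul]
    exact (setIntegral_congr_fun measurableSet_Ioo heq).symm

theorem locallyIntegrable_of_forall_intervalIntegrable {f : ℝ → ℝ}
    (hf : ∀ a b, IntervalIntegrable f volume a b) : LocallyIntegrable f := by
  rw [locallyIntegrable_iff]
  intro K hK
  obtain ⟨r, hr⟩ := hK.isBounded.subset_closedBall 0
  rw [Real.closedBall_eq_Icc] at hr
  refine IntegrableOn.mono_set ?_ hr
  rcases le_or_gt (0 - r) (0 + r) with h | h
  · exact (intervalIntegrable_iff_integrableOn_Icc_of_le h).1 (hf _ _)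
  · rw [Set.Icc_eq_empty_of_lt h]
    exact integrableOn_empty

/-- The one-sided power kernel `x₊ ^ (-δ)`. -/
noncomputable def posRpow (δ : ℝ) : ℝ → ℝ := Set.indicator (Set.Ioi 0) fun x => x ^ (-δ)

theorem posRpow_of_pos (δ : ℝ) {x : ℝ} (hx : 0 < x) : posRpow δ x = x ^ (-δ) :=
  Set.indicator_of_mem (Set.mem_Ioi.2 hx) _

theorem posRpow_of_nonpos (δ : ℝ) {x : ℝ} (hx : x ≤ 0) : posRpow δ x = 0 :=
  Set.indicator_of_notMem (by simpa using hx) _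

@[fun_prop]
theorem measurable_posRpow (δ : ℝ) : Measurable (posRpow δ) :=
  Measurable.indicator (by fun_prop) measurableSet_Ioi

theorem intervalIntegrable_posRpow {δ : ℝ} (hδ : δ < 1) (a b : ℝ) :
    IntervalIntegrable (posRpow δ) volume a b := by
  have h := intervalIntegral.intervalIntegrable_rpow' (a := a) (b := b)
    (show -1 < -δ by linarith)
  rw [intervalIntegrable_iff] at h ⊢
  exact h.indicator measurableSet_Ioi

theorem locallyIntegrable_posRpow {δ : ℝ} (hδ : δ < 1) : LocallyIntegrable (posRpow δ) :=
  locallyIntegrable_of_forall_intervalIntegrable (intervalIntegrable_posRpow hδ)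

theorem locallyIntegrable_posRpow_neg {δ : ℝ} (hδ : δ < 1) :
    LocallyIntegrable fun x => posRpow δ (-x) :=
  locallyIntegrable_of_forall_intervalIntegrable fun a b => by
    rw [IntervalIntegrable.iff_comp_neg]
    simpa using intervalIntegrable_posRpow hδ (-a) (-b)

section Convolution

variable {k k₁ k₂ g : ℝ → ℝ}

theorem MeasureTheory.LocallyIntegrable.norm (hk : LocallyIntegrable k) :
    LocallyIntegrable fun x => ‖k x‖ := fun x => by
  obtain ⟨s, hs, h⟩ := hk x
  exact ⟨s, hs, h.norm⟩

theorem convolution_mul_eq (k g : ℝ → ℝ) :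
    convolution k g (ContinuousLinearMap.mul ℝ ℝ) volume = fun s => ∫ a, k (s - a) * g a :=
  funext fun _ => convolution_eq_swap _

theorem integrable_kernel_sub_mul (hk : LocallyIntegrable k) (hg : Continuous g)
    (hgs : HasCompactSupport g) (s : ℝ) : Integrable fun a => k (s - a) * g a :=
  (hgs.convolutionExists_right (ContinuousLinearMap.mul ℝ ℝ) hk hg s).integrable_swap

theorem continuous_integral_kernel_sub_mul (hk : LocallyIntegrable k) (hg : Continuous g)
    (hgs : HasCompactSupport g) : Continuous fun s => ∫ a, k (s - a) * g a := by
  have h := hgs.continuous_convolution_right (ContinuousLinearMap.mul ℝ ℝ) hk hg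
  rwa [convolution_mul_eq] at h

theorem hasDerivAt_integral_kernel_sub_mul (hk : LocallyIntegrable k) (hg : ContDiff ℝ 1 g)
    (hgs : HasCompactSupport g) (s : ℝ) :
    HasDerivAt (fun s => ∫ a, k (s - a) * g a) (∫ a, k (s - a) * deriv g a) s := by
  have h := hgs.hasDerivAt_convolution_right (ContinuousLinearMap.mul ℝ ℝ) hk hg s
  rwa [convolution_mul_eq, convolution_mul_eq] at h

theorem integrable_mul_mul_kernel_sub (hkm : Measurable k) (hk : LocallyIntegrable k)
    (hg : Continuous g) (hgs : HasCompactSupport g) :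
    Integrable fun p : ℝ × ℝ => g p.1 * g p.2 * k (p.1 - p.2) := by
  have hm : Measurable g := hg.measurable
  rw [Measure.volume_eq_prod, integrable_prod_iff (by fun_prop)]
  constructor
  · refine Filter.Eventually.of_forall fun x => ?_
    refine ((integrable_kernel_sub_mul hk hg hgs x).const_mul (g x)).congr ?_
    exact Filter.Eventually.of_forall fun y => by simp only; ring
  · have hc := continuous_integral_kernel_sub_mul hk.norm hg.norm hgs.norm
    have : Integrable fun x => ‖g x‖ * ∫ a, ‖k (x - a)‖ * ‖g a‖ :=
      (hg.norm.mul hc).integrable_of_hasCompactSupport hgs.norm.mul_right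
    refine this.congr (Filter.Eventually.of_forall fun x => ?_)
    simp only [← integral_const_mul, norm_mul]
    congr 1
    ext y
    ring

theorem setIntegral_mul_integral_kernel (hm₁ : Measurable k₁) (hm₂ : Measurable k₂)
    (hk₁ : LocallyIntegrable k₁) (hk₂ : LocallyIntegrable k₂)
    (hg : Continuous g) (hgs : HasCompactSupport g) {S : Set ℝ} (hS : IsCompact S) :
    Integrable (fun p : ℝ × ℝ => g p.1 * g p.2 * ∫ s in S, k₁ (s - p.1) * k₂ (s - p.2)) ∧
    ∫ s in S, (∫ a, k₁ (s - a) * g a) * (∫ b, k₂ (s - b) * g b) =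
      ∫ p : ℝ × ℝ, g p.1 * g p.2 * ∫ s in S, k₁ (s - p.1) * k₂ (s - p.2) := by
  have hm : Measurable g := hg.measurable
  have hint : Integrable (Function.uncurry fun (s : ℝ) (p : ℝ × ℝ) =>
      (k₁ (s - p.1) * g p.1) * (k₂ (s - p.2) * g p.2))
      ((volume.restrict S).prod (volume : Measure (ℝ × ℝ))) := by
    rw [integrable_prod_iff (by unfold Function.uncurry; fun_prop)]
    constructor
    · refine Filter.Eventually.of_forall fun s => ?_
      exact (integrable_kernel_sub_mul hk₁ hg hgs s).mul_prod
        (integrable_kernel_sub_mul hk₂ hg hgs s)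
    · have h₁ := continuous_integral_kernel_sub_mul hk₁.norm hg.norm hgs.norm
      have h₂ := continuous_integral_kernel_sub_mul hk₂.norm hg.norm hgs.norm
      refine ((h₁.mul h₂).continuousOn.integrableOn_compact hS).congr
        (Filter.Eventually.of_forall fun s => ?_)
      simp only [Function.uncurry, norm_mul]
      exact (integral_prod_mul (fun a => ‖k₁ (s - a)‖ * ‖g a‖)
        (fun b => ‖k₂ (s - b)‖ * ‖g b‖)).symm
  have heq : ∀ p : ℝ × ℝ, ∫ s in S, (k₁ (s - p.1) * g p.1) * (k₂ (s - p.2) * g p.2) =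
      g p.1 * g p.2 * ∫ s in S, k₁ (s - p.1) * k₂ (s - p.2) := fun p => by
    rw [← integral_const_mul]
    congr 1
    ext s
    ring
  have hi := hint.integral_prod_right
  have h := integral_integral_swap hint
  simp only [Function.uncurry, heq] at hi h
  refine ⟨hi, ?_⟩
  rw [← h]
  congr 1
  ext s
  exact (integral_prod_mul (fun a => k₁ (s - a) * g a) (fun b => k₂ (s - b) * g b)).symm

end Convolution

theorem setIntegral_Icc_posRpow_mul_posRpow_neg {δ L a b : ℝ} (hδ : δ < 1) (ha : -L ≤ a)
    (hb : b ≤ L) :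
    ∫ s in Set.Icc (-L) L, posRpow δ (s - a) * posRpow δ (-(s - b)) =
      posRpow (2 * δ - 1) (b - a) * ProbabilityTheory.beta (1 - δ) (1 - δ) := by
  have heq : (fun s => posRpow δ (s - a) * posRpow δ (-(s - b))) =
      Set.indicator (Set.Ioo a b) fun s => (s - a) ^ (-δ) * (b - s) ^ (-δ) := by
    ext s
    by_cases hs : s ∈ Set.Ioo a b
    · rw [Set.indicator_of_mem hs, posRpow_of_pos _ (by linarith [hs.1]),
        posRpow_of_pos _ (by linarith [hs.2]), neg_sub]
    · rw [Set.indicator_of_notMem hs]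
      rcases le_or_gt s a with h | h
      · rw [posRpow_of_nonpos δ (by linarith), zero_mul]
      · have : b ≤ s := by
          by_contra! h'
          exact hs ⟨h, h'⟩
        rw [posRpow_of_nonpos δ (show -(s - b) ≤ 0 by linarith), mul_zero]
  have hsub : Set.Ioo a b ⊆ Set.Icc (-L) L := fun s hs =>
    ⟨ha.trans hs.1.le, hs.2.le.trans hb⟩
  rw [heq, setIntegral_indicator measurableSet_Ioo, Set.inter_eq_right.2 hsub]
  rcases lt_or_ge a b with h | h
  · rw [integral_Ioo_sub_rpow_mul_sub_rpow h hδ, posRpow_of_pos _ (by linarith)]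
    ring_nf
  · rw [posRpow_of_nonpos _ (by linarith), Set.Ioo_eq_empty (by linarith)]
    simp

theorem setIntegral_Icc_posRpow_mul_posRpow {δ L a b R : ℝ} (ha : -L ≤ a) (hab : a < b)
    (hbR : b ≤ R) :
    ∫ s in Set.Icc (-L) R, posRpow δ (s - a) * posRpow δ (s - b) =
      ∫ s in b..R, (s - b) ^ (-δ) * (s - a) ^ (-δ) := by
  have heq : (fun s => posRpow δ (s - a) * posRpow δ (s - b)) =
      Set.indicator (Set.Ioi b) fun s => (s - b) ^ (-δ) * (s - a) ^ (-δ) := by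
    ext s
    by_cases hs : s ∈ Set.Ioi b
    · have hs' := Set.mem_Ioi.1 hs
      rw [Set.indicator_of_mem hs, posRpow_of_pos _ (by linarith),
        posRpow_of_pos _ (by linarith), mul_comm]
    · rw [Set.indicator_of_notMem hs, posRpow_of_nonpos δ (x := s - b) (by
        have := Set.notMem_Ioi.1 hs; linarith), mul_zero]
  have hset : Set.Icc (-L) R ∩ Set.Ioi b = Set.Ioc b R := by
    ext s
    simp only [Set.mem_inter_iff, Set.mem_Icc, Set.mem_Ioi, Set.mem_Ioc]
    constructor
    · rintro ⟨⟨_, h⟩, h'⟩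
      exact ⟨h', h⟩
    · rintro ⟨h, h'⟩
      exact ⟨⟨by linarith, h'⟩, h⟩
  rw [heq, setIntegral_indicator measurableSet_Ioi, hset, intervalIntegral.integral_of_le hbR]

theorem intervalIntegrable_sub_rpow_mul_sub_rpow {δ r a b R : ℝ} (hδ : δ < 1) (hab : a < b)
    (hbR : b ≤ R) :
    IntervalIntegrable (fun s => (s - b) ^ (-δ) * (s - a) ^ r) volume b R := by
  refine IntervalIntegrable.mul_continuousOn ?_ ?_
  · have := (intervalIntegral.intervalIntegrable_rpow' (a := b - b) (b := R - b)
      (show -1 < -δ by linarith)).comp_sub_right b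
    simpa using this
  · refine ContinuousOn.rpow_const (by fun_prop) fun s hs => Or.inl ?_
    rw [Set.uIcc_of_le hbR] at hs
    have := hs.1
    have : 0 < s - a := by linarith
    exact this.ne'

theorem integral_sub_rpow_mul_sub_rpow {δ a b R : ℝ} (hδ : δ < 1) (hab : a < b)
    (hbR : b ≤ R) :
    (1 - 2 * δ) * ∫ s in b..R, (s - b) ^ (-δ) * (s - a) ^ (-δ) =
      (R - b) ^ (1 - δ) * (R - a) ^ (-δ) -
        δ * (b - a) * ∫ s in b..R, (s - b) ^ (-δ) * (s - a) ^ (-δ - 1) := by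
  have h1 := intervalIntegrable_sub_rpow_mul_sub_rpow (r := -δ) hδ hab hbR
  have h2 := intervalIntegrable_sub_rpow_mul_sub_rpow (r := -δ - 1) hδ hab hbR
  have hF := intervalIntegral.integral_eq_sub_of_hasDerivAt_of_le hbR
    (f := fun s => (s - b) ^ (1 - δ) * (s - a) ^ (-δ))
    (f' := fun s => (1 - 2 * δ) * ((s - b) ^ (-δ) * (s - a) ^ (-δ)) +
      δ * (b - a) * ((s - b) ^ (-δ) * (s - a) ^ (-δ - 1))) ?_ ?_
    ((h1.const_mul _).add (h2.const_mul _))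
  · rw [intervalIntegral.integral_add (h1.const_mul _) (h2.const_mul _),
      intervalIntegral.integral_const_mul, intervalIntegral.integral_const_mul, sub_self,
      zero_rpow (by linarith), zero_mul, sub_zero] at hF
    linarith
  · refine ContinuousOn.mul ?_ ?_
    · exact ContinuousOn.rpow_const (by fun_prop) fun s hs => Or.inr (by linarith)
    · refine ContinuousOn.rpow_const (by fun_prop) fun s hs => Or.inl ?_
      have := hs.1
      have : 0 < s - a := by linarith
      exact this.ne'
  · intro s hs
    have hsb : 0 < s - b := by linarith [hs.1]
    have hsa : 0 < s - a := by linarith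
    have d1 := ((hasDerivAt_id s).sub_const b).rpow_const (p := 1 - δ) (Or.inl hsb.ne')
    have d2 := ((hasDerivAt_id s).sub_const a).rpow_const (p := -δ) (Or.inl hsa.ne')
    refine (d1.mul d2).congr_deriv ?_
    have e1 : (s - b) ^ (1 - δ) = (s - b) * (s - b) ^ (-δ) := by
      rw [sub_eq_add_neg 1 δ, rpow_add hsb, rpow_one]
    have e2 : (s - a) ^ (-δ) = (s - a) * (s - a) ^ (-δ - 1) := by
      rw [rpow_sub hsa, rpow_one]
      field_simp
    have e3 : 1 - δ - 1 = -δ := by ring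
    simp only [id, e1, e2, e3]
    ring

theorem integral_Ioi_sub_rpow_mul_sub_rpow {δ a b : ℝ} (hδ0 : 0 < δ) (hδ1 : δ < 1)
    (hab : a < b) :
    IntegrableOn (fun s => (s - b) ^ (-δ) * (s - a) ^ (-δ - 1)) (Set.Ioi b) ∧
    ∫ s in Set.Ioi b, (s - b) ^ (-δ) * (s - a) ^ (-δ - 1) =
      (b - a) ^ (-(2 * δ)) * ProbabilityTheory.beta (1 - δ) (2 * δ) := by
  have h := integrableOn_Ioi_rpow_mul_add_rpow (a := 1 - δ) (b := 2 * δ) (c := b - a)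
    (by linarith) (by linarith) (by linarith)
  have himg : (fun x : ℝ => x + b) '' Set.Ioi 0 = Set.Ioi b := by simp
  have hder : ∀ x ∈ Set.Ioi (0 : ℝ), HasDerivWithinAt (fun x : ℝ => x + b) 1 (Set.Ioi 0) x :=
    fun x _ => ((hasDerivAt_id x).add_const b).hasDerivWithinAt
  have hinj : Set.InjOn (fun x : ℝ => x + b) (Set.Ioi 0) := fun x _ y _ h => by simpa using h
  have heq : (fun x : ℝ => |(1 : ℝ)| • ((x + b - b) ^ (-δ) * (x + b - a) ^ (-δ - 1))) =
      fun u => u ^ (1 - δ - 1) * (u + (b - a)) ^ (-(1 - δ + 2 * δ)) := by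
    ext x
    simp only [abs_one, one_smul]
    congr 2 <;> ring
  constructor
  · rw [← himg, integrableOn_image_iff_integrableOn_abs_deriv_smul measurableSet_Ioi hder hinj,
      heq]
    exact h.1
  · rw [← himg, integral_image_eq_integral_abs_deriv_smul measurableSet_Ioi hder hinj, heq]
    exact h.2

theorem abs_sub_rpow_mul_sub_rpow_sub_rpow_le {δ L a b R : ℝ} (hδ0 : 0 < δ) (hδ1 : δ < 1)
    (ha : |a| ≤ L) (hb : |b| ≤ L) (hR : 2 * L + 2 ≤ R) :
    |(R - b) ^ (1 - δ) * (R - a) ^ (-δ) - R ^ (1 - 2 * δ)| ≤ 5 * L * (R / 2) ^ (-(2 * δ)) := by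
  have hL : 0 ≤ L := (abs_nonneg a).trans ha
  have hRpos : 0 < R := by linarith
  have hbd : ∀ t ∈ Set.Icc (0 : ℝ) 1, ∀ c : ℝ, |c| ≤ L → R / 2 ≤ R - t * c ∧ R - t * c ≤ 2 * R := by
    intro t ht c hc
    have : |t * c| ≤ L := by
      rw [abs_mul, abs_of_nonneg ht.1]
      nlinarith [ht.2, abs_nonneg c]
    have := abs_le.1 this
    constructor <;> linarith
  have h := norm_image_sub_le_of_norm_deriv_le_segment_01'
    (f := fun t => (R - t * b) ^ (1 - δ) * (R - t * a) ^ (-δ))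
    (f' := fun t => -(b * (1 - δ) * ((R - t * b) ^ (-δ) * (R - t * a) ^ (-δ))) +
      a * δ * ((R - t * b) ^ (1 - δ) * (R - t * a) ^ (-δ - 1)))
    (C := 5 * L * (R / 2) ^ (-(2 * δ))) ?_ ?_
  · simp only [one_mul, zero_mul, sub_zero] at h
    rwa [← rpow_add hRpos, show 1 - δ + -δ = 1 - 2 * δ by ring] at h
  · intro t ht
    have hb' : 0 < R - t * b := by linarith [(hbd t ht b hb).1]
    have ha' : 0 < R - t * a := by linarith [(hbd t ht a ha).1]
    have d1 := (((hasDerivAt_id t).mul_const b).const_sub R).rpow_const (p := 1 - δ)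
      (Or.inl hb'.ne')
    have d2 := (((hasDerivAt_id t).mul_const a).const_sub R).rpow_const (p := -δ)
      (Or.inl ha'.ne')
    refine ((d1.mul d2).congr_deriv ?_).hasDerivWithinAt
    have e3 : 1 - δ - 1 = -δ := by ring
    simp only [id, e3]
    ring
  · intro t ht
    obtain ⟨hb1, hb2⟩ := hbd t ⟨ht.1, ht.2.le⟩ b hb
    obtain ⟨ha1, ha2⟩ := hbd t ⟨ht.1, ht.2.le⟩ a ha
    have hb' : 0 < R - t * b := by linarith
    have ha' : 0 < R - t * a := by linarith
    have e0 : (R / 2) ^ (-(2 * δ)) = (R / 2) ^ (-δ) * (R / 2) ^ (-δ) := by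
      rw [← rpow_add (by linarith)]; ring_nf
    have e1 : (R - t * b) ^ (1 - δ) = (R - t * b) * (R - t * b) ^ (-δ) := by
      rw [sub_eq_add_neg 1 δ, rpow_add hb', rpow_one]
    have e2 : (R - t * a) ^ (-δ - 1) = (R - t * a) ^ (-δ) / (R - t * a) := by
      rw [rpow_sub ha', rpow_one]
    have i1 : (R - t * b) ^ (-δ) ≤ (R / 2) ^ (-δ) :=
      rpow_le_rpow_of_nonpos (by linarith) hb1 (by linarith)
    have i2 : (R - t * a) ^ (-δ) ≤ (R / 2) ^ (-δ) :=
      rpow_le_rpow_of_nonpos (by linarith) ha1 (by linarith)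
    have hP : (R - t * b) ^ (-δ) * (R - t * a) ^ (-δ) ≤ (R / 2) ^ (-(2 * δ)) := by
      rw [e0]; gcongr
    have hP0 : 0 ≤ (R - t * b) ^ (-δ) * (R - t * a) ^ (-δ) := by positivity
    have hq : (R - t * b) / (R - t * a) ≤ 4 := by
      rw [div_le_iff₀ ha']; linarith
    have hq0 : 0 ≤ (R - t * b) / (R - t * a) := by positivity
    set P := (R - t * b) ^ (-δ) * (R - t * a) ^ (-δ) with hPdef
    set q := (R - t * b) / (R - t * a) with hqdef
    have e4 : (R - t * b) ^ (1 - δ) * (R - t * a) ^ (-δ - 1) = q * P := by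
      rw [e1, e2, hqdef, hPdef]; ring
    rw [e4, Real.norm_eq_abs]
    have t1 : |-(b * (1 - δ) * P)| ≤ L * P := by
      rw [abs_neg, abs_mul, abs_mul, abs_of_nonneg hP0, abs_of_nonneg (by linarith : 0 ≤ 1 - δ)]
      gcongr
      nlinarith [abs_nonneg b]
    have t2 : |a * δ * (q * P)| ≤ L * (4 * P) := by
      rw [abs_mul, abs_mul, abs_of_nonneg (mul_nonneg hq0 hP0), abs_of_pos hδ0]
      gcongr
      nlinarith [abs_nonneg a]
    calc _ ≤ _ := abs_add_le _ _
      _ ≤ L * P + L * (4 * P) := add_le_add t1 t2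
      _ = 5 * L * P := by ring
      _ ≤ _ := by gcongr

/-- Renormalised Gram kernel of the truncated one-sided powers: its limit and a uniform bound. -/
theorem gram_posRpow_of_lt {δ L a b : ℝ} (hδ0 : 0 < δ) (hδ1 : δ < 1) (ha : |a| ≤ L)
    (hb : |b| ≤ L) (hab : a < b) :
    (∀ R, 2 * L + 2 ≤ R →
      |(1 - 2 * δ) * (∫ s in Set.Icc (-L) R, posRpow δ (s - a) * posRpow δ (s - b)) -
        R ^ (1 - 2 * δ)| ≤
      5 * L + δ * ProbabilityTheory.beta (1 - δ) (2 * δ) * posRpow (2 * δ - 1) (b - a)) ∧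
    Filter.Tendsto (fun R => (1 - 2 * δ) *
        (∫ s in Set.Icc (-L) R, posRpow δ (s - a) * posRpow δ (s - b)) - R ^ (1 - 2 * δ))
      Filter.atTop
      (nhds (-(δ * ProbabilityTheory.beta (1 - δ) (2 * δ) * posRpow (2 * δ - 1) (b - a)))) := by
  have hL : 0 ≤ L := (abs_nonneg a).trans ha
  have hba : 0 < b - a := by linarith
  obtain ⟨hi, hI⟩ := integral_Ioi_sub_rpow_mul_sub_rpow hδ0 hδ1 hab
  have hpow : (b - a) ^ (-(2 * δ - 1)) = (b - a) * (b - a) ^ (-(2 * δ)) := by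
    rw [show -(2 * δ - 1) = 1 + -(2 * δ) by ring, rpow_add hba, rpow_one]
  have hlim : δ * ProbabilityTheory.beta (1 - δ) (2 * δ) * posRpow (2 * δ - 1) (b - a) =
      δ * (b - a) * ∫ s in Set.Ioi b, (s - b) ^ (-δ) * (s - a) ^ (-δ - 1) := by
    rw [hI, posRpow_of_pos _ hba, hpow]
    ring
  have hR : ∀ R, 2 * L + 2 ≤ R →
      (1 - 2 * δ) * (∫ s in Set.Icc (-L) R, posRpow δ (s - a) * posRpow δ (s - b)) -
        R ^ (1 - 2 * δ) = ((R - b) ^ (1 - δ) * (R - a) ^ (-δ) - R ^ (1 - 2 * δ)) -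
          δ * (b - a) * ∫ s in b..R, (s - b) ^ (-δ) * (s - a) ^ (-δ - 1) := by
    intro R hR
    have hbR : b ≤ R := by linarith [(abs_le.1 hb).2]
    rw [setIntegral_Icc_posRpow_mul_posRpow (abs_le.1 ha).1 hab hbR,
      integral_sub_rpow_mul_sub_rpow hδ1 hab hbR]
    ring
  rw [hlim]
  constructor
  · intro R hR2
    have hbR : b ≤ R := by linarith [(abs_le.1 hb).2]
    have hnn : ∀ s ∈ Set.Ioi b, 0 ≤ (s - b) ^ (-δ) * (s - a) ^ (-δ - 1) := by
      intro s hs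
      have h1 : 0 < s - b := by linarith [Set.mem_Ioi.1 hs]
      have h2 : 0 < s - a := by linarith
      positivity
    have hle : ∫ s in b..R, (s - b) ^ (-δ) * (s - a) ^ (-δ - 1) ≤
        ∫ s in Set.Ioi b, (s - b) ^ (-δ) * (s - a) ^ (-δ - 1) := by
      rw [intervalIntegral.integral_of_le hbR]
      exact setIntegral_mono_set hi ((ae_restrict_iff' measurableSet_Ioi).2
        (Filter.Eventually.of_forall hnn)) (Filter.Eventually.of_forall fun s hs => hs.1)
    have h0 : 0 ≤ ∫ s in b..R, (s - b) ^ (-δ) * (s - a) ^ (-δ - 1) := by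
      rw [intervalIntegral.integral_of_le hbR]
      exact setIntegral_nonneg measurableSet_Ioc fun s hs => hnn s hs.1
    rw [hR R hR2]
    refine (abs_sub _ _).trans (add_le_add ?_ ?_)
    · refine (abs_sub_rpow_mul_sub_rpow_sub_rpow_le hδ0 hδ1 ha hb hR2).trans ?_
      exact mul_le_of_le_one_right (by linarith)
        (rpow_le_one_of_one_le_of_nonpos (by linarith) (by linarith))
    · rw [abs_of_nonneg (by positivity)]
      gcongr
  · have hz : Filter.Tendsto (fun R => (R - b) ^ (1 - δ) * (R - a) ^ (-δ) - R ^ (1 - 2 * δ))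
        Filter.atTop (nhds 0) := by
      have h5 : Filter.Tendsto (fun R : ℝ => 5 * L * (R / 2) ^ (-(2 * δ))) Filter.atTop
          (nhds 0) := by
        have := ((tendsto_rpow_neg_atTop (show 0 < 2 * δ by linarith)).comp
          (Filter.tendsto_id.atTop_div_const (show (0 : ℝ) < 2 by norm_num))).const_mul (5 * L)
        simpa using this
      refine squeeze_zero_norm' ?_ h5
      filter_upwards [Filter.eventually_ge_atTop (2 * L + 2)] with R hR2
      exact abs_sub_rpow_mul_sub_rpow_sub_rpow_le hδ0 hδ1 ha hb hR2
    have h2 := (intervalIntegral_tendsto_integral_Ioi b hi Filter.tendsto_id).const_mul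
      (δ * (b - a))
    have h3 := hz.sub h2
    rw [zero_sub] at h3
    refine h3.congr' ?_
    filter_upwards [Filter.eventually_ge_atTop (2 * L + 2)] with R hR2
    exact (hR R hR2).symm

theorem ae_fst_ne_snd : ∀ᵐ p : ℝ × ℝ, p.1 ≠ p.2 := by
  have hm : MeasurableSet {p : ℝ × ℝ | p.1 = p.2} :=
    (isClosed_eq continuous_fst continuous_snd).measurableSet
  have h : (volume : Measure (ℝ × ℝ)) {p : ℝ × ℝ | p.1 = p.2} = 0 := by
    rw [Measure.volume_eq_prod, Measure.measure_prod_null hm]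
    refine Filter.Eventually.of_forall fun x => ?_
    have : Prod.mk x ⁻¹' {p : ℝ × ℝ | p.1 = p.2} = {x} := by
      ext y
      simp [eq_comm]
    simp [this]
  rw [ae_iff]
  simpa using h

/-- The Riesz-type energy of `g` with the one-sided kernel `x₊ ^ (1 - 2δ)`. -/
noncomputable def posRpowEnergy (δ : ℝ) (g : ℝ → ℝ) : ℝ :=
  ∫ p : ℝ × ℝ, g p.1 * g p.2 * posRpow (2 * δ - 1) (p.1 - p.2)

section Energy

variable {δ L : ℝ} {g : ℝ → ℝ}

theorem posRpowEnergy_eq_swap (δ : ℝ) (g : ℝ → ℝ) :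
    ∫ p : ℝ × ℝ, g p.1 * g p.2 * posRpow (2 * δ - 1) (p.2 - p.1) = posRpowEnergy δ g := by
  rw [posRpowEnergy, Measure.volume_eq_prod, ← integral_prod_swap]
  congr 1
  ext p
  simp only [Prod.fst_swap, Prod.snd_swap]
  ring

theorem integrable_energy_integrand (hδ1 : δ < 1) (hg : Continuous g)
    (hgs : HasCompactSupport g) :
    Integrable (fun p : ℝ × ℝ => g p.1 * g p.2 * posRpow (2 * δ - 1) (p.1 - p.2)) ∧
    Integrable (fun p : ℝ × ℝ => g p.1 * g p.2 * posRpow (2 * δ - 1) (p.2 - p.1)) := by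
  have h := integrable_mul_mul_kernel_sub (measurable_posRpow (2 * δ - 1))
    (locallyIntegrable_posRpow (by linarith)) hg hgs
  refine ⟨h, ?_⟩
  rw [Measure.volume_eq_prod] at h ⊢
  refine h.swap.congr (Filter.Eventually.of_forall fun p => ?_)
  simp only [Function.comp, Prod.fst_swap, Prod.snd_swap]
  ring

theorem posRpowEnergy_half (hg : Continuous g) (hgs : HasCompactSupport g)
    (hg0 : ∫ x, g x = 0) : posRpowEnergy (1 / 2) g = 0 := by
  obtain ⟨h1, h2⟩ := integrable_energy_integrand (δ := 1 / 2) (by norm_num) hg hgs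
  have h := integral_add h1 h2
  rw [posRpowEnergy_eq_swap, ← posRpowEnergy] at h
  have h0 : ∫ p : ℝ × ℝ, (g p.1 * g p.2 * posRpow (2 * (1 / 2) - 1) (p.1 - p.2) +
      g p.1 * g p.2 * posRpow (2 * (1 / 2) - 1) (p.2 - p.1)) = ∫ p : ℝ × ℝ, g p.1 * g p.2 := by
    refine integral_congr_ae ?_
    filter_upwards [ae_fst_ne_snd] with p hp
    rcases lt_or_gt_of_ne hp with hlt | hlt
    · rw [posRpow_of_nonpos _ (by linarith : p.1 - p.2 ≤ 0), posRpow_of_pos _ (by linarith)]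
      norm_num
    · rw [posRpow_of_nonpos _ (by linarith : p.2 - p.1 ≤ 0), posRpow_of_pos _ (by linarith)]
      norm_num
  have h3 : ∫ p : ℝ × ℝ, g p.1 * g p.2 = (∫ x, g x) * ∫ x, g x := integral_prod_mul g g
  rw [h0, h3, hg0] at h
  linarith

theorem integral_left_eq_zero (hgL : ∀ x, g x ≠ 0 → |x| ≤ L) {s : ℝ} (hs : s ≤ -L) :
    ∫ a, posRpow δ (s - a) * g a = 0 := by
  rw [← integral_zero ℝ ℝ]
  congr 1
  ext a
  by_cases ha : g a = 0
  · simp [ha]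
  · rw [posRpow_of_nonpos _ (by linarith [(abs_le.1 (hgL a ha)).1]), zero_mul]

theorem integral_right_eq_zero (hgL : ∀ x, g x ≠ 0 → |x| ≤ L) {s : ℝ} (hs : L ≤ s) :
    ∫ a, posRpow δ (-(s - a)) * g a = 0 := by
  rw [← integral_zero ℝ ℝ]
  congr 1
  ext a
  by_cases ha : g a = 0
  · simp [ha]
  · rw [posRpow_of_nonpos _ (by linarith [(abs_le.1 (hgL a ha)).2]), zero_mul]

theorem integral_left_mul_right (hδ1 : δ < 1) (hg : Continuous g) (hgs : HasCompactSupport g)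
    (hgL : ∀ x, g x ≠ 0 → |x| ≤ L) :
    ∫ s, (∫ a, posRpow δ (s - a) * g a) * (∫ b, posRpow δ (-(s - b)) * g b) =
      ProbabilityTheory.beta (1 - δ) (1 - δ) * posRpowEnergy δ g := by
  have hS : ∫ s in Set.Icc (-L) L,
      (∫ a, posRpow δ (s - a) * g a) * (∫ b, posRpow δ (-(s - b)) * g b) =
      ∫ s, (∫ a, posRpow δ (s - a) * g a) * (∫ b, posRpow δ (-(s - b)) * g b) := by
    refine setIntegral_eq_integral_of_forall_compl_eq_zero fun s hs => ?_
    rcases le_or_gt s (-L) with h | h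
    · rw [integral_left_eq_zero hgL h, zero_mul]
    · have : L ≤ s := by
        by_contra! h'
        exact hs ⟨h.le, h'.le⟩
      rw [integral_right_eq_zero hgL this, mul_zero]
  rw [← hS, (setIntegral_mul_integral_kernel (k₂ := fun x => posRpow δ (-x))
    (measurable_posRpow δ) (by fun_prop) (locallyIntegrable_posRpow hδ1)
    (locallyIntegrable_posRpow_neg hδ1) hg hgs isCompact_Icc).2, ← posRpowEnergy_eq_swap,
    ← integral_const_mul]
  congr 1
  ext p
  by_cases h1 : g p.1 = 0
  · simp [h1]
  by_cases h2 : g p.2 = 0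
  · simp [h2]
  rw [setIntegral_Icc_posRpow_mul_posRpow_neg hδ1 (abs_le.1 (hgL _ h1)).1 (abs_le.1 (hgL _ h2)).2]
  ring

theorem gram_posRpow_of_ne {a b : ℝ} (hδ0 : 0 < δ) (hδ1 : δ < 1) (ha : |a| ≤ L)
    (hb : |b| ≤ L) (hab : a ≠ b) :
    (∀ R, 2 * L + 2 ≤ R →
      |(1 - 2 * δ) * (∫ s in Set.Icc (-L) R, posRpow δ (s - a) * posRpow δ (s - b)) -
        R ^ (1 - 2 * δ)| ≤
      5 * L + δ * ProbabilityTheory.beta (1 - δ) (2 * δ) *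
        (posRpow (2 * δ - 1) (a - b) + posRpow (2 * δ - 1) (b - a))) ∧
    Filter.Tendsto (fun R => (1 - 2 * δ) *
        (∫ s in Set.Icc (-L) R, posRpow δ (s - a) * posRpow δ (s - b)) - R ^ (1 - 2 * δ))
      Filter.atTop
      (nhds (-(δ * ProbabilityTheory.beta (1 - δ) (2 * δ) *
        (posRpow (2 * δ - 1) (a - b) + posRpow (2 * δ - 1) (b - a))))) := by
  rcases lt_or_gt_of_ne hab with h | h
  · rw [posRpow_of_nonpos _ (by linarith : a - b ≤ 0), zero_add]
    exact gram_posRpow_of_lt hδ0 hδ1 ha hb h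
  · rw [posRpow_of_nonpos _ (by linarith : b - a ≤ 0), add_zero]
    simp only [mul_comm (posRpow δ (_ - a))]
    exact gram_posRpow_of_lt hδ0 hδ1 hb ha h

theorem tendsto_setIntegral_left_sq (hδ0 : 0 < δ) (hδ1 : δ < 1) (hg : Continuous g)
    (hgs : HasCompactSupport g) (hgL : ∀ x, g x ≠ 0 → |x| ≤ L) (hg0 : ∫ x, g x = 0) :
    Filter.Tendsto (fun R => (1 - 2 * δ) *
        ∫ s in Set.Icc (-L) R, (∫ a, posRpow δ (s - a) * g a) ^ 2) Filter.atTop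
      (nhds (-(2 * δ * ProbabilityTheory.beta (1 - δ) (2 * δ) * posRpowEnergy δ g))) := by
  set β := ProbabilityTheory.beta (1 - δ) (2 * δ) with hβ
  set κ := posRpow (2 * δ - 1) with hκ
  have hF := fun R : ℝ => setIntegral_mul_integral_kernel (measurable_posRpow δ)
    (measurable_posRpow δ) (locallyIntegrable_posRpow hδ1) (locallyIntegrable_posRpow hδ1)
    hg hgs (isCompact_Icc (a := -L) (b := R))
  obtain ⟨hi1, hi2⟩ := integrable_energy_integrand hδ1 hg hgs
  have hgg : Integrable fun p : ℝ × ℝ => g p.1 * g p.2 :=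
    (hg.integrable_of_hasCompactSupport hgs).mul_prod (hg.integrable_of_hasCompactSupport hgs)
  have hgg0 : ∫ p : ℝ × ℝ, g p.1 * g p.2 = 0 := by
    rw [show ∫ p : ℝ × ℝ, g p.1 * g p.2 = (∫ x, g x) * ∫ x, g x from integral_prod_mul g g,
      hg0, zero_mul]
  set E : ℝ → ℝ × ℝ → ℝ := fun R p => g p.1 * g p.2 * ((1 - 2 * δ) *
    (∫ s in Set.Icc (-L) R, posRpow δ (s - p.1) * posRpow δ (s - p.2)) - R ^ (1 - 2 * δ)) with hE
  have hE' : ∀ R, E R = fun p => (1 - 2 * δ) * (g p.1 * g p.2 *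
      ∫ s in Set.Icc (-L) R, posRpow δ (s - p.1) * posRpow δ (s - p.2)) -
      R ^ (1 - 2 * δ) * (g p.1 * g p.2) := by
    intro R
    ext p
    simp only [hE]
    ring
  have hEi : ∀ R, Integrable (E R) := fun R => by
    rw [hE']
    exact ((hF R).1.const_mul _).sub (hgg.const_mul _)
  have hEint : ∀ R, ∫ p, E R p = (1 - 2 * δ) *
      ∫ s in Set.Icc (-L) R, (∫ a, posRpow δ (s - a) * g a) ^ 2 := fun R => by
    rw [hE', integral_sub ((hF R).1.const_mul _) (hgg.const_mul _), integral_const_mul,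
      integral_const_mul, hgg0, ← (hF R).2]
    simp only [pow_two, mul_zero, sub_zero]
  have hsum : -(2 * δ * β * posRpowEnergy δ g) =
      ∫ p : ℝ × ℝ, g p.1 * g p.2 * -(δ * β * (κ (p.1 - p.2) + κ (p.2 - p.1))) := by
    have : (fun p : ℝ × ℝ => g p.1 * g p.2 * -(δ * β * (κ (p.1 - p.2) + κ (p.2 - p.1)))) =
        fun p => -(δ * β) * (g p.1 * g p.2 * κ (p.1 - p.2) + g p.1 * g p.2 * κ (p.2 - p.1)) := by
      ext p
      ring
    rw [this, integral_const_mul, integral_add hi1 hi2, posRpowEnergy_eq_swap, ← posRpowEnergy]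
    ring
  rw [hsum]
  simp only [← hEint]
  refine tendsto_integral_filter_of_dominated_convergence
    (fun p => 5 * L * ‖g p.1 * g p.2‖ + δ * |β| * (‖g p.1 * g p.2 * κ (p.1 - p.2)‖ +
      ‖g p.1 * g p.2 * κ (p.2 - p.1)‖)) (Filter.Eventually.of_forall fun R => (hEi R).1) ?_
    ((hgg.norm.const_mul _).add ((hi1.norm.add hi2.norm).const_mul _)) ?_
  · filter_upwards [Filter.eventually_ge_atTop (2 * L + 2)] with R hR
    filter_upwards [ae_fst_ne_snd] with p hp
    by_cases h1 : g p.1 = 0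
    · simp [hE, h1]
    by_cases h2 : g p.2 = 0
    · simp [hE, h2]
    have hb := (gram_posRpow_of_ne hδ0 hδ1 (hgL _ h1) (hgL _ h2) hp).1 R hR
    simp only [hE, norm_mul, Real.norm_eq_abs] at hb ⊢
    refine (mul_le_mul_of_nonneg_left hb (by positivity)).trans ?_
    rw [← hβ, ← hκ]
    have i1 := le_abs_self β
    have i2 := le_abs_self (κ (p.1 - p.2))
    have i3 := le_abs_self (κ (p.2 - p.1))
    have hκ0 : ∀ x, 0 ≤ κ x := fun x => Set.indicator_nonneg
      (fun y hy => rpow_nonneg (le_of_lt hy) _) x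
    calc _ ≤ |g p.1| * |g p.2| * (5 * L + δ * |β| * (|κ (p.1 - p.2)| + |κ (p.2 - p.1)|)) := by
          have := hκ0 (p.1 - p.2)
          have := hκ0 (p.2 - p.1)
          gcongr
      _ = _ := by ring
  · filter_upwards [ae_fst_ne_snd] with p hp
    by_cases h1 : g p.1 = 0
    · simp [hE, h1]
    by_cases h2 : g p.2 = 0
    · simp [hE, h2]
    exact ((gram_posRpow_of_ne hδ0 hδ1 (hgL _ h1) (hgL _ h2) hp).2).const_mul _

theorem integral_left_sq (hδ0 : 0 < δ) (hδ1 : δ < 1) (hδ : δ ≠ 1 / 2) (hg : Continuous g)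
    (hgs : HasCompactSupport g) (hgL : ∀ x, g x ≠ 0 → |x| ≤ L) (hg0 : ∫ x, g x = 0) :
    (1 - 2 * δ) * ∫ s, (∫ a, posRpow δ (s - a) * g a) ^ 2 =
      -(2 * δ * ProbabilityTheory.beta (1 - δ) (2 * δ) * posRpowEnergy δ g) := by
  have hne : 1 - 2 * δ ≠ 0 := fun h => hδ (by linarith)
  have hc : Continuous fun s => (∫ a, posRpow δ (s - a) * g a) ^ 2 :=
    (continuous_integral_kernel_sub_mul (locallyIntegrable_posRpow hδ1) hg hgs).pow 2
  have ht := (tendsto_setIntegral_left_sq hδ0 hδ1 hg hgs hgL hg0).const_mul (1 - 2 * δ)⁻¹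
  simp only [inv_mul_cancel_left₀ hne] at ht
  have ht' : Filter.Tendsto (fun R => ∫ s in (-L)..R, (∫ a, posRpow δ (s - a) * g a) ^ 2)
      Filter.atTop (nhds ((1 - 2 * δ)⁻¹ *
        -(2 * δ * ProbabilityTheory.beta (1 - δ) (2 * δ) * posRpowEnergy δ g))) := by
    refine ht.congr' ?_
    filter_upwards [Filter.eventually_ge_atTop (-L)] with R hR
    rw [intervalIntegral.integral_of_le hR, integral_Icc_eq_integral_Ioc]
  have hi := integrableOn_Ioi_of_intervalIntegral_norm_tendsto _ (-L)
    (f := fun s => (∫ a, posRpow δ (s - a) * g a) ^ 2)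
    (fun R => (hc.integrableOn_Icc (a := -L) (b := R)).mono_set Set.Ioc_subset_Icc_self)
    Filter.tendsto_id (by simpa only [norm_pow, Real.norm_eq_abs, sq_abs] using ht')
  have hu := tendsto_nhds_unique ht'
    (intervalIntegral_tendsto_integral_Ioi (-L) hi Filter.tendsto_id)
  have hS : ∫ s in Set.Ioi (-L), (∫ a, posRpow δ (s - a) * g a) ^ 2 =
      ∫ s, (∫ a, posRpow δ (s - a) * g a) ^ 2 := by
    refine setIntegral_eq_integral_of_forall_compl_eq_zero fun s hs => ?_
    rw [integral_left_eq_zero hgL (Set.notMem_Ioi.1 hs), zero_pow two_ne_zero]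
  rw [← hS, ← hu, mul_inv_cancel_left₀ hne]

theorem beta_mul_eq_cos_mul_beta (hδ0 : 0 < δ) (hδ1 : δ < 1) (hδ : δ ≠ 1 / 2) :
    (1 - 2 * δ) * ProbabilityTheory.beta (1 - δ) (1 - δ) =
      Real.cos (Real.pi * δ) * (2 * δ * ProbabilityTheory.beta (1 - δ) (2 * δ)) := by
  have hne : 1 - 2 * δ ≠ 0 := fun h => hδ (by linarith)
  have hπ := Real.pi_pos
  have h1 := Real.Gamma_mul_Gamma_one_sub δ
  have h2 := Real.Gamma_mul_Gamma_one_sub (2 * δ)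
  have g1 : Real.Gamma (1 - δ + (1 - δ)) = (1 - 2 * δ) * Real.Gamma (1 - 2 * δ) := by
    rw [← Real.Gamma_add_one hne]
    ring_nf
  have g2 : Real.Gamma (1 - δ + 2 * δ) = δ * Real.Gamma δ := by
    rw [← Real.Gamma_add_one hδ0.ne']
    ring_nf
  have hs : 0 < Real.sin (Real.pi * δ) :=
    Real.sin_pos_of_pos_of_lt_pi (by positivity) (by nlinarith)
  have hcos : Real.cos (Real.pi * δ) ≠ 0 := by
    intro h
    rw [Real.cos_eq_zero_iff] at h
    obtain ⟨n, hn⟩ := h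
    have h3 : δ = (2 * n + 1) / 2 := by
      have : Real.pi * (δ - (2 * n + 1) / 2) = 0 := by linarith
      rcases mul_eq_zero.1 this with h | h
      · exact absurd h hπ.ne'
      · linarith
    have h4 : (-1 : ℝ) < 2 * n := by linarith
    have h5 : (2 * n : ℝ) < 1 := by linarith
    have h6 : n = 0 := by
      have : (-1 : ℤ) < 2 * n := by exact_mod_cast h4
      have : (2 * n : ℤ) < 1 := by exact_mod_cast h5
      omega
    exact hδ (by rw [h3, h6]; norm_num)
  have hGδ := (Real.Gamma_pos_of_pos hδ0).ne'
  have hG2 := (Real.Gamma_pos_of_pos (show 0 < 2 * δ by linarith)).ne'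
  have h2s : Real.sin (Real.pi * (2 * δ)) = 2 * Real.sin (Real.pi * δ) * Real.cos (Real.pi * δ) := by
    rw [← Real.sin_two_mul]
    ring_nf
  rw [h2s] at h2
  have e1 : Real.Gamma (1 - δ) = Real.pi / Real.sin (Real.pi * δ) / Real.Gamma δ := by
    rw [eq_div_iff hGδ, mul_comm, h1]
  have e2 : Real.Gamma (1 - 2 * δ) =
      Real.pi / (2 * Real.sin (Real.pi * δ) * Real.cos (Real.pi * δ)) / Real.Gamma (2 * δ) := by
    rw [eq_div_iff hG2, mul_comm, h2]
  rw [ProbabilityTheory.beta, ProbabilityTheory.beta, g1, g2, e1, e2]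
  field_simp

/-- Cosine identity for the two one-sided fractional integrals of a mean-zero function. -/
theorem integral_left_mul_right_eq_cos (hδ0 : 0 < δ) (hδ1 : δ < 1) (hg : Continuous g)
    (hgs : HasCompactSupport g) (hg0 : ∫ x, g x = 0) :
    -∫ s, (∫ a, posRpow δ (s - a) * g a) * (∫ b, posRpow δ (-(s - b)) * g b) =
      Real.cos (Real.pi * δ) * ∫ s, (∫ a, posRpow δ (s - a) * g a) ^ 2 := by
  obtain ⟨L, hL⟩ := hgs.isBounded.subset_closedBall 0
  have hgL : ∀ x, g x ≠ 0 → |x| ≤ L := fun x hx => by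
    simpa using hL (subset_tsupport g hx)
  rw [integral_left_mul_right hδ1 hg hgs hgL]
  by_cases hδ : δ = 1 / 2
  · rw [hδ, posRpowEnergy_half hg hgs hg0, show Real.pi * (1 / 2) = Real.pi / 2 by ring,
      Real.cos_pi_div_two]
    simp
  · have hne : 1 - 2 * δ ≠ 0 := fun h => hδ (by linarith)
    have h1 := integral_left_sq hδ0 hδ1 hδ hg hgs hgL hg0
    have h2 := beta_mul_eq_cos_mul_beta hδ0 hδ1 hδ
    apply mul_left_cancel₀ hne
    rw [mul_left_comm, h1]
    linear_combination -(posRpowEnergy δ g) * h2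

end Energy

section ChangeOfVariables

variable {ψ : ℝ → ℝ}

theorem integral_deriv_mul_comp_of_bijective (hψ : Differentiable ℝ ψ)
    (hbij : Function.Bijective ψ) (hψ' : ∀ t, 0 < deriv ψ t) (F : ℝ → ℝ) :
    ∫ t, deriv ψ t * F (ψ t) = ∫ s, F s := by
  have h := integral_image_eq_integral_abs_deriv_smul (f := ψ) (f' := deriv ψ) MeasurableSet.univ
    (fun x _ => (hψ x).hasDerivAt.hasDerivWithinAt) hbij.1.injOn F
  rw [Set.image_univ, hbij.2.range_eq, Measure.restrict_univ] at h
  rw [h]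
  simp only [abs_of_pos (hψ' _), smul_eq_mul]

theorem setIntegral_Iio_eq_integral_posRpow (hmono : StrictMono ψ) (δ : ℝ) (v : ℝ → ℝ) (τ : ℝ) :
    ∫ z in Set.Iio τ, deriv ψ z * (ψ τ - ψ z) ^ (-δ) * v z =
      ∫ z, deriv ψ z * (posRpow δ (ψ τ - ψ z) * v z) := by
  rw [← integral_indicator measurableSet_Iio]
  congr 1
  ext z
  by_cases hz : z < τ
  · rw [Set.indicator_of_mem (Set.mem_Iio.2 hz), posRpow_of_pos _ (by linarith [hmono hz])]
    ring
  · rw [Set.indicator_of_notMem (by simpa using hz),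
      posRpow_of_nonpos _ (by linarith [hmono.monotone (not_lt.1 hz)])]
    ring

theorem setIntegral_Ioi_eq_integral_posRpow (hmono : StrictMono ψ) (δ : ℝ) (v : ℝ → ℝ) (τ : ℝ) :
    ∫ z in Set.Ioi τ, deriv ψ z * (ψ z - ψ τ) ^ (-δ) * v z =
      ∫ z, deriv ψ z * (posRpow δ (-(ψ τ - ψ z)) * v z) := by
  rw [← integral_indicator measurableSet_Ioi]
  congr 1
  ext z
  by_cases hz : τ < z
  · rw [Set.indicator_of_mem (Set.mem_Ioi.2 hz), posRpow_of_pos _ (by linarith [hmono hz])]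
    ring_nf
  · rw [Set.indicator_of_notMem (by simpa using hz),
      posRpow_of_nonpos _ (by linarith [hmono.monotone (not_lt.1 hz)])]
    ring

variable {δ : ℝ} {v w : ℝ → ℝ}

theorem leftRLDLine_eq (hδ1 : δ < 1) (hψ : Differentiable ℝ ψ) (hmono : StrictMono ψ)
    (hbij : Function.Bijective ψ) (hψ' : ∀ t, 0 < deriv ψ t) (hw : ContDiff ℝ 1 w)
    (hws : HasCompactSupport w) (hvw : ∀ t, v t = w (ψ t)) (t : ℝ) :
    leftRLDLine ψ δ v t =
      1 / Real.Gamma (1 - δ) * ∫ a, posRpow δ (ψ t - a) * deriv w a := by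
  have hP : ∀ τ, ∫ z in Set.Iio τ, deriv ψ z * (ψ τ - ψ z) ^ (-δ) * v z =
      ∫ a, posRpow δ (ψ τ - a) * w a := fun τ => by
    rw [setIntegral_Iio_eq_integral_posRpow hmono]
    simp only [hvw]
    exact integral_deriv_mul_comp_of_bijective hψ hbij hψ' fun a => posRpow δ (ψ τ - a) * w a
  have hd := ((hasDerivAt_integral_kernel_sub_mul (locallyIntegrable_posRpow hδ1) hw hws
    (ψ t)).comp t (hψ t).hasDerivAt).const_mul (1 / Real.Gamma (1 - δ))
  simp only [Function.comp_def] at hd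
  simp only [leftRLDLine, hP]
  rw [hd.deriv]
  have := (hψ' t).ne'
  field_simp

theorem rightRLDLine_eq (hδ1 : δ < 1) (hψ : Differentiable ℝ ψ) (hmono : StrictMono ψ)
    (hbij : Function.Bijective ψ) (hψ' : ∀ t, 0 < deriv ψ t) (hw : ContDiff ℝ 1 w)
    (hws : HasCompactSupport w) (hvw : ∀ t, v t = w (ψ t)) (t : ℝ) :
    rightRLDLine ψ δ v t =
      -(1 / Real.Gamma (1 - δ) * ∫ a, posRpow δ (-(ψ t - a)) * deriv w a) := by
  have hP : ∀ τ, ∫ z in Set.Ioi τ, deriv ψ z * (ψ z - ψ τ) ^ (-δ) * v z =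
      ∫ a, posRpow δ (-(ψ τ - a)) * w a := fun τ => by
    rw [setIntegral_Ioi_eq_integral_posRpow hmono]
    simp only [hvw]
    exact integral_deriv_mul_comp_of_bijective hψ hbij hψ' fun a => posRpow δ (-(ψ τ - a)) * w a
  have hd := ((hasDerivAt_integral_kernel_sub_mul (locallyIntegrable_posRpow_neg hδ1) hw hws
    (ψ t)).comp t (hψ t).hasDerivAt).const_mul (1 / Real.Gamma (1 - δ))
  simp only [Function.comp_def] at hd
  simp only [rightRLDLine, hP]
  rw [hd.deriv]
  have := (hψ' t).ne'
  field_simp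

theorem exists_contDiff_comp_eq (hψ : ContDiff ℝ 1 ψ) (hmono : StrictMono ψ)
    (hbij : Function.Bijective ψ) (hψ' : ∀ t, 0 < deriv ψ t) (hv : ContDiff ℝ 1 v)
    (hsupp : HasCompactSupport v) :
    ∃ w : ℝ → ℝ, ContDiff ℝ 1 w ∧ HasCompactSupport w ∧ ∀ t, v t = w (ψ t) := by
  set e : ℝ ≃o ℝ := hmono.orderIsoOfSurjective ψ hbij.2 with he
  have hee : ∀ t, e t = ψ t := fun t => rfl
  have hc : Continuous e.symm := e.symm.continuous
  have hd : ∀ s, HasDerivAt e.symm (deriv ψ (e.symm s))⁻¹ s := fun s =>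
    HasDerivAt.of_local_left_inverse hc.continuousAt
      ((hψ.differentiable one_ne_zero) (e.symm s)).hasDerivAt (hψ' _).ne'
      (Filter.Eventually.of_forall fun y => e.apply_symm_apply y)
  have hdw : ∀ s, HasDerivAt (v ∘ e.symm) (deriv v (e.symm s) * (deriv ψ (e.symm s))⁻¹) s :=
    fun s => ((hv.differentiable one_ne_zero) (e.symm s)).hasDerivAt.comp s (hd s)
  refine ⟨v ∘ e.symm, ?_, hsupp.comp_homeomorph e.symm.toHomeomorph, fun t => ?_⟩
  · rw [contDiff_one_iff_deriv]
    refine ⟨fun s => (hdw s).differentiableAt, ?_⟩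
    rw [funext fun s => (hdw s).deriv]
    exact ((hv.continuous_deriv le_rfl).comp hc).mul
      (((hψ.continuous_deriv le_rfl).comp hc).inv₀ fun s => (hψ' _).ne')
  · rw [← hee, Function.comp, e.symm_apply_apply]

end ChangeOfVariables

/-- Cosine identity for the mixed ψ-fractional pairing on ℝ:
`(D^{δ,ψ}v, D^{δ,ψ}_-v)_{L²_ψ(ℝ)} = cos(πδ) ‖D^{δ,ψ}v‖²_{L²_ψ(ℝ)}`. -/
theorem cosine_identity_mixed_psi_pairing
    (δ : ℝ) (hδ0 : 0 < δ) (hδ1 : δ < 1)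
    (ψ : ℝ → ℝ) (hψ : ContDiff ℝ 1 ψ) (hmono : StrictMono ψ)
    (hbij : Function.Bijective ψ) (hψ' : ∀ t, 0 < deriv ψ t)
    (v : ℝ → ℝ) (hv : ContDiff ℝ (⊤ : ℕ∞) v) (hsupp : HasCompactSupport v) :
    ∫ t : ℝ, leftRLDLine ψ δ v t * rightRLDLine ψ δ v t * deriv ψ t
      = Real.cos (Real.pi * δ) * ∫ t : ℝ, (leftRLDLine ψ δ v t) ^ 2 * deriv ψ t := by
  obtain ⟨w, hw, hws, hvw⟩ :=
    exists_contDiff_comp_eq hψ hmono hbij hψ' (hv.of_le (by exact_mod_cast le_top)) hsupp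
  have hψd := hψ.differentiable one_ne_zero
  simp only [leftRLDLine_eq hδ1 hψd hmono hbij hψ' hw hws hvw,
    rightRLDLine_eq hδ1 hψd hmono hbij hψ' hw hws hvw]
  have hdw := hw.continuous_deriv le_rfl
  have hw0 : ∫ x, deriv w x = 0 := integral_eq_zero_of_hasDerivAt_of_integrable
    (fun x => (hw.differentiable one_ne_zero x).hasDerivAt)
    (hdw.integrable_of_hasCompactSupport hws.deriv) (hw.continuous.integrable_of_hasCompactSupport hws)
  have hmain := integral_left_mul_right_eq_cos hδ0 hδ1 hdw hws.deriv hw0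
  rw [← integral_deriv_mul_comp_of_bijective hψd hbij hψ'
    (fun s => (∫ a, posRpow δ (s - a) * deriv w a) * ∫ b, posRpow δ (-(s - b)) * deriv w b),
    ← integral_deriv_mul_comp_of_bijective hψd hbij hψ'
    (fun s => (∫ a, posRpow δ (s - a) * deriv w a) ^ 2)] at hmain
  set c := 1 / Real.Gamma (1 - δ)
  calc _ = c ^ 2 * -∫ t, deriv ψ t * ((∫ a, posRpow δ (ψ t - a) * deriv w a) *
        ∫ b, posRpow δ (-(ψ t - b)) * deriv w b) := by
        rw [← integral_neg, ← integral_const_mul]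
        congr 1
        ext t
        ring
    _ = Real.cos (Real.pi * δ) *
        (c ^ 2 * ∫ t, deriv ψ t * (∫ a, posRpow δ (ψ t - a) * deriv w a) ^ 2) := by
        rw [hmain]
        ring
    _ = _ := by
        rw [← integral_const_mul]
        congr 2
        ext t
        ring
end

section
/- (Lemma 2.5, first inequality: ψ-fractional Poincaré–Friedrichs inequality for the left derivative.) There exists a constant C > 0, depending only on δ, ψ and Λ, such that for every v ∈ C_c^∞(Λ) one has ||v||_{L²_ψ(Λ)} ≤ C ||D^{δ,ψ}_t v||_{L²_ψ(Λ)}. -/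
open MeasureTheory Real

/-- Left ψ-fractional integral on `Λ = (a,b)`. -/
noncomputable def leftPsiI (ψ : ℝ → ℝ) (a μ : ℝ) (v : ℝ → ℝ) (t : ℝ) : ℝ :=
  (1 / Real.Gamma μ) * ∫ z in a..t, deriv ψ z * (ψ t - ψ z) ^ (μ - 1) * v z

/-- Left ψ-Riemann–Liouville derivative on `Λ = (a,b)`:
`D^{μ,ψ}_t v(t) = (1/ψ'(t)) d/dt [I^{1-μ,ψ}_t v(t)]`. -/
noncomputable def leftPsiD (ψ : ℝ → ℝ) (a μ : ℝ) (v : ℝ → ℝ) (t : ℝ) : ℝ :=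
  (1 / deriv ψ t) * deriv (fun τ => leftPsiI ψ a (1 - μ) v τ) t

/-- The weighted `L²_ψ(Λ)` norm. -/
noncomputable def psiNorm (ψ : ℝ → ℝ) (a b : ℝ) (v : ℝ → ℝ) : ℝ :=
  Real.sqrt (∫ t in a..b, (v t) ^ 2 * deriv ψ t)

open Set Filter Topology ContinuousLinearMap
open scoped Convolution ENNReal

/-- The kernel `u ↦ u ^ (μ - 1) / Γ(μ)` of the fractional integral of order `μ`, truncated to
`(0, M)`. -/
noncomputable def truncKernel (M μ : ℝ) : ℝ → ℝ :=
  indicator (Ioo 0 M) fun u => u ^ (μ - 1) / Real.Gamma μ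

lemma truncKernel_of_mem {M μ u : ℝ} (hu : u ∈ Ioo 0 M) :
    truncKernel M μ u = u ^ (μ - 1) / Real.Gamma μ := indicator_of_mem hu _

lemma truncKernel_of_notMem {M μ u : ℝ} (hu : u ∉ Ioo 0 M) : truncKernel M μ u = 0 :=
  indicator_of_notMem hu _

lemma integrable_truncKernel {M μ : ℝ} (hμ : 0 < μ) : Integrable (truncKernel M μ) := by
  rw [truncKernel, integrable_indicator_iff measurableSet_Ioo]
  refine Integrable.div_const ?_ _
  rcases le_or_gt M 0 with hM | hM
  · simp [Ioo_eq_empty_of_le hM]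
  · have := intervalIntegral.intervalIntegrable_rpow' (a := 0) (b := M) (r := μ - 1) (by linarith)
    rw [intervalIntegrable_iff_integrableOn_Ioo_of_le hM.le] at this
    exact this

lemma hasCompactSupport_truncKernel (M μ : ℝ) : HasCompactSupport (truncKernel M μ) :=
  HasCompactSupport.intro (isCompact_Icc (a := (0 : ℝ)) (b := M)) fun _ hx =>
    truncKernel_of_notMem fun h => hx (Ioo_subset_Icc_self h)

lemma integral_rpow_mul_sub_rpow {α β x : ℝ} (hα : 0 < α) (hβ : 0 < β) (hx : 0 < x) :
    ∫ u in 0..x, u ^ (α - 1) * (x - u) ^ (β - 1) =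
      x ^ (α + β - 1) * (Real.Gamma α * Real.Gamma β / Real.Gamma (α + β)) := by
  have h := Complex.betaIntegral_scaled α β hx
  rw [Complex.betaIntegral_eq_Gamma_mul_div _ _ (by simpa) (by simpa), ← Complex.ofReal_add,
    Complex.Gamma_ofReal, Complex.Gamma_ofReal, Complex.Gamma_ofReal] at h
  apply Complex.ofReal_injective
  rw [← intervalIntegral.integral_ofReal]
  push_cast [Complex.ofReal_cpow hx.le] at h ⊢
  rw [← h]
  refine intervalIntegral.integral_congr fun u hu => ?_
  rw [uIcc_of_le hx.le] at hu
  rw [Complex.ofReal_cpow hu.1, Complex.ofReal_cpow (sub_nonneg.2 hu.2)]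
  push_cast
  rfl

lemma truncKernel_convolution_of_nonpos {M α β x : ℝ} (hx : x ≤ 0) :
    (truncKernel M α ⋆ truncKernel M β) x = 0 := by
  rw [convolution_def]
  refine integral_eq_zero_of_ae (Eventually.of_forall fun u => ?_)
  by_cases hu : 0 < u
  · have : truncKernel M β (x - u) = 0 := truncKernel_of_notMem fun h => by linarith [h.1]
    simp [this]
  · have : truncKernel M α u = 0 := truncKernel_of_notMem fun h => hu h.1
    simp [this]

lemma truncKernel_convolution_eq_one {M α β x : ℝ} (hα : 0 < α) (hβ : 0 < β) (hαβ : α + β = 1)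
    (hx : x ∈ Ioo 0 M) : (truncKernel M α ⋆ truncKernel M β) x = 1 := by
  have hΓα := (Real.Gamma_pos_of_pos hα).ne'
  have hΓβ := (Real.Gamma_pos_of_pos hβ).ne'
  have h := integral_rpow_mul_sub_rpow hα hβ hx.1
  rw [hαβ, sub_self, rpow_zero, Real.Gamma_one, intervalIntegral.integral_of_le hx.1.le,
    integral_Ioc_eq_integral_Ioo, ← integral_indicator measurableSet_Ioo] at h
  have : (truncKernel M α ⋆ truncKernel M β) x =
      ∫ u, (1 / (Real.Gamma α * Real.Gamma β)) *
        indicator (Ioo 0 x) (fun u => u ^ (α - 1) * (x - u) ^ (β - 1)) u := by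
    rw [convolution_def]
    congr 1
    ext u
    by_cases hu : u ∈ Ioo 0 x
    · rw [indicator_of_mem hu, truncKernel_of_mem ⟨hu.1, hu.2.trans hx.2⟩,
        truncKernel_of_mem ⟨by linarith [hu.2], by linarith [hu.1, hx.2]⟩]
      simp only [lsmul_apply, smul_eq_mul]
      field_simp
    · rw [indicator_of_notMem hu]
      by_cases hu0 : 0 < u
      · have : truncKernel M β (x - u) = 0 :=
          truncKernel_of_notMem fun h => hu ⟨hu0, by linarith [h.1]⟩
        simp [this]
      · have : truncKernel M α u = 0 := truncKernel_of_notMem fun h => hu0 h.1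
        simp [this]
  rw [this, integral_const_mul, h]
  field_simp

lemma HasCompactSupport.integral_Ioi_deriv_sub_left {w : ℝ → ℝ} (hc : HasCompactSupport w)
    (hw : ContDiff ℝ 1 w) (x : ℝ) : ∫ t in Ioi 0, deriv w (x - t) = w x := by
  have hf : ContDiff ℝ 1 fun t => w (x - t) := hw.comp (contDiff_const.sub contDiff_id)
  have hfc : HasCompactSupport fun t => w (x - t) := hc.comp_homeomorph (Homeomorph.subLeft x)
  have h := hfc.integral_Ioi_deriv_eq hf 0
  simp only [deriv_comp_const_sub, integral_neg, sub_zero, neg_inj] at h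
  exact h

/-- The fractional integral of order `α` of the fractional derivative of order `α`
gives back the function. -/
lemma truncKernel_convolution_convolution_deriv {M α β A x : ℝ} {w : ℝ → ℝ} (hα : 0 < α)
    (hβ : 0 < β) (hαβ : α + β = 1) (hw : ContDiff ℝ 1 w) (hc : HasCompactSupport w)
    (hA : tsupport w ⊆ Ioi A) (hx : x < A + M) :
    (truncKernel M α ⋆ (truncKernel M β ⋆ deriv w)) x = w x := by
  have hw' : Continuous (deriv w) := hw.continuous_deriv le_rfl
  have hα_int := integrable_truncKernel (M := M) hα
  have hβ_int := integrable_truncKernel (M := M) hβ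
  have hassoc : ((truncKernel M α ⋆ truncKernel M β) ⋆ deriv w) x =
      (truncKernel M α ⋆ (truncKernel M β ⋆ deriv w)) x := by
    refine convolution_assoc _ _ _ _ (fun a b c => mul_assoc a b c) hα_int.aestronglyMeasurable
      hβ_int.aestronglyMeasurable hw'.aestronglyMeasurable
      (hα_int.ae_convolution_exists _ hβ_int) (Eventually.of_forall fun y => ?_) ?_
    · exact hc.deriv.norm.convolutionExists_right _ hβ_int.norm.locallyIntegrable hw'.norm y
    · refine HasCompactSupport.convolutionExists_right _ ?_ hα_int.norm.locallyIntegrable ?_ x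
      · exact HasCompactSupport.convolution _ (hasCompactSupport_truncKernel M β).norm
          hc.deriv.norm
      · exact hc.deriv.norm.continuous_convolution_right _ hβ_int.norm.locallyIntegrable hw'.norm
  rw [← hassoc, convolution_def, ← hc.integral_Ioi_deriv_sub_left hw x,
    ← integral_indicator measurableSet_Ioi]
  congr 1
  ext t
  by_cases ht : 0 < t
  · rw [indicator_of_mem (mem_Ioi.2 ht)]
    by_cases htM : t < M
    · simp [truncKernel_convolution_eq_one hα hβ hαβ ⟨ht, htM⟩]
    · have : deriv w (x - t) = 0 := by
        by_contra h
        have := hA (support_deriv_subset (Function.mem_support.2 h))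
        simp only [mem_Ioi] at this
        linarith
      simp [this]
  · rw [indicator_of_notMem (by simpa using ht), truncKernel_convolution_of_nonpos (not_lt.1 ht)]
    simp

/-- Young's convolution inequality `L¹ * L² ⊆ L²`. -/
lemma lintegral_sq_lintegral_mul_sub_le {f g : ℝ → ℝ≥0∞} (hf : Measurable f) (hg : Measurable g) :
    ∫⁻ s, (∫⁻ u, f u * g (s - u)) ^ 2 ≤ (∫⁻ u, f u) ^ 2 * ∫⁻ u, g u ^ 2 := by
  have hcs : ∀ s, (∫⁻ u, f u * g (s - u)) ^ 2 ≤ (∫⁻ u, f u) * ∫⁻ u, f u * g (s - u) ^ 2 := by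
    intro s
    have h := ENNReal.lintegral_mul_le_Lp_mul_Lq (volume : Measure ℝ) Real.HolderConjugate.two_two
      (f := fun u => f u ^ (1 / 2 : ℝ)) (g := fun u => f u ^ (1 / 2 : ℝ) * g (s - u))
      (by fun_prop) (by fun_prop)
    have e1 : ∀ u, ((fun u => f u ^ (1 / 2 : ℝ)) * fun u => f u ^ (1 / 2 : ℝ) * g (s - u)) u =
        f u * g (s - u) := fun u => by
      simp only [Pi.mul_apply]
      rw [← mul_assoc, ← ENNReal.rpow_add_of_nonneg _ _ (by norm_num) (by norm_num)]
      norm_num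
    have e2 : ∀ u, (f u ^ (1 / 2 : ℝ)) ^ (2 : ℝ) = f u := fun u => by
      rw [← ENNReal.rpow_mul]; norm_num
    have e3 : ∀ u, (f u ^ (1 / 2 : ℝ) * g (s - u)) ^ (2 : ℝ) = f u * g (s - u) ^ 2 := fun u => by
      rw [ENNReal.mul_rpow_of_nonneg _ _ (by norm_num), e2, ENNReal.rpow_two]
    simp only [e1, e2, e3] at h
    calc _ ≤ _ := pow_le_pow_left' h 2
      _ = _ := by
        rw [mul_pow, ← ENNReal.rpow_two, ← ENNReal.rpow_two, ← ENNReal.rpow_mul,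
          ← ENNReal.rpow_mul]
        norm_num
  calc ∫⁻ s, (∫⁻ u, f u * g (s - u)) ^ 2
      ≤ ∫⁻ s, (∫⁻ u, f u) * ∫⁻ u, f u * g (s - u) ^ 2 := lintegral_mono hcs
    _ = (∫⁻ u, f u) * ∫⁻ s, ∫⁻ u, f u * g (s - u) ^ 2 := by
        rw [lintegral_const_mul]
        exact Measurable.lintegral_prod_right' (f := fun p : ℝ × ℝ => f p.2 * g (p.1 - p.2) ^ 2)
          (by fun_prop)
    _ = (∫⁻ u, f u) * ∫⁻ u, ∫⁻ s, f u * g (s - u) ^ 2 := by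
        rw [lintegral_lintegral_swap]
        fun_prop
    _ = (∫⁻ u, f u) * ∫⁻ u, f u * ∫⁻ s, g s ^ 2 := by
        congr 2
        ext u
        rw [lintegral_const_mul _ (by fun_prop),
          lintegral_sub_right_eq_self (fun s => g s ^ 2) u]
    _ = _ := by rw [lintegral_mul_const _ hf]; ring

/-- On a bounded interval, causal convolution with an `L¹` kernel is bounded on `L²`. -/
lemma integral_sq_convolution_le {k g : ℝ → ℝ} {A B : ℝ} (hAB : A ≤ B) (hk : Measurable k)
    (hk_int : Integrable k) (hk0 : ∀ u ≤ 0, k u = 0) (hg : Continuous g)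
    (hg0 : ∀ s ≤ A, g s = 0) (hkg : ContinuousOn (k ⋆ g) (Icc A B)) :
    ∫ s in A..B, ((k ⋆ g) s) ^ 2 ≤ (∫ u, ‖k u‖) ^ 2 * ∫ s in A..B, g s ^ 2 := by
  have hint : ∀ {h : ℝ → ℝ}, ContinuousOn h (Icc A B) →
      ENNReal.ofReal (∫ s in A..B, h s ^ 2) = ∫⁻ s in Ioc A B, ‖h s‖ₑ ^ 2 := by
    intro h hh
    have : IntegrableOn (fun s => h s ^ 2) (Ioc A B) :=
      ((hh.pow 2).integrableOn_Icc).mono_set Ioc_subset_Icc_self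
    rw [intervalIntegral.integral_of_le hAB, ofReal_integral_eq_lintegral_ofReal this
      (Eventually.of_forall fun s => sq_nonneg _)]
    refine lintegral_congr fun s => ?_
    rw [← sq_abs, ENNReal.ofReal_pow (abs_nonneg _), Real.enorm_eq_ofReal_abs]
  have hnn : 0 ≤ ∫ s in A..B, g s ^ 2 :=
    intervalIntegral.integral_nonneg hAB fun s _ => sq_nonneg _
  rw [← ENNReal.ofReal_le_ofReal_iff (by positivity), ENNReal.ofReal_mul (by positivity),
    ENNReal.ofReal_pow (by positivity), ofReal_integral_norm_eq_lintegral_enorm hk_int,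
    hint hkg, hint hg.continuousOn]
  set G : ℝ → ℝ≥0∞ := indicator (Ioc A B) fun s => ‖g s‖ₑ with hG
  have hGm : Measurable G := (by fun_prop : Measurable fun s => ‖g s‖ₑ).indicator measurableSet_Ioc
  have hGsq : ∫⁻ s, G s ^ 2 = ∫⁻ s in Ioc A B, ‖g s‖ₑ ^ 2 := by
    rw [← lintegral_indicator measurableSet_Ioc]
    refine lintegral_congr fun s => ?_
    by_cases hs : s ∈ Ioc A B <;> simp [hG, hs]
  rw [← hGsq]
  refine le_trans ?_ (lintegral_sq_lintegral_mul_sub_le hk.enorm hGm)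
  refine le_trans (setLIntegral_mono' measurableSet_Ioc fun s hs => ?_)
    (setLIntegral_le_lintegral (Ioc A B) _)
  gcongr
  rw [convolution_def]
  refine (enorm_integral_le_lintegral_enorm _).trans (lintegral_mono fun u => ?_)
  simp only [lsmul_apply, smul_eq_mul, enorm_mul]
  by_cases hu : u ≤ 0
  · simp [hk0 u hu]
  by_cases hsu : s - u ≤ A
  · simp [hg0 _ hsu]
  · have : s - u ∈ Ioc A B := ⟨by linarith, by linarith [hs.2]⟩
    simp [hG, this]

lemma leftPsiI_eq_truncKernel_convolution {ψ v w : ℝ → ℝ} {a t M μ : ℝ}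
    (hψ : Differentiable ℝ ψ) (hψ' : ∀ t, 0 < deriv ψ t) (hwv : ∀ z, w (ψ z) = v z)
    (hw : ∀ x ≤ ψ a, w x = 0) (hat : ψ a < ψ t) (hM : ψ t < ψ a + M) :
    leftPsiI ψ a μ v t = (truncKernel M μ ⋆ w) (ψ t) := by
  have h1 := intervalIntegral.integral_comp_mul_deriv_of_deriv_nonneg (a := a) (b := t)
    (f := ψ) (f' := deriv ψ) (g := fun x => (ψ t - x) ^ (μ - 1) * w x)
    hψ.continuous.continuousOn (fun x _ => (hψ x).hasDerivAt) (fun x _ => (hψ' x).le)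
  have h2 := intervalIntegral.integral_comp_sub_left (a := ψ a) (b := ψ t)
    (fun u => u ^ (μ - 1) * w (ψ t - u)) (ψ t)
  simp only [sub_sub_cancel, sub_self] at h2
  have h3 : leftPsiI ψ a μ v t =
      1 / Real.Gamma μ * ∫ u in 0..ψ t - ψ a, u ^ (μ - 1) * w (ψ t - u) := by
    rw [leftPsiI, ← h2, ← h1]
    congr 2
    ext z
    simp only [Function.comp_apply, hwv]
    ring
  rw [h3, intervalIntegral.integral_of_le (by linarith), ← integral_indicator measurableSet_Ioc,
    ← integral_const_mul, convolution_def]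
  congr 1
  ext u
  simp only [lsmul_apply, smul_eq_mul]
  by_cases hu : u ∈ Ioc 0 (ψ t - ψ a)
  · rw [indicator_of_mem hu, truncKernel_of_mem ⟨hu.1, by linarith [hu.2]⟩]
    ring
  · rw [indicator_of_notMem hu]
    by_cases hu0 : 0 < u
    · have : ψ t - ψ a < u := by
        by_contra h
        exact hu ⟨hu0, not_lt.1 h⟩
      simp [hw (ψ t - u) (by linarith)]
    · simp [truncKernel_of_notMem (M := M) (μ := μ) fun h => hu0 h.1]

lemma psiNorm_eq_sqrt_integral {ψ v w : ℝ → ℝ} {a b : ℝ} (hab : a ≤ b)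
    (hψ : Differentiable ℝ ψ) (hψ' : ∀ t, 0 < deriv ψ t) (hwv : ∀ z ∈ Ioo a b, w (ψ z) = v z) :
    psiNorm ψ a b v = Real.sqrt (∫ x in ψ a..ψ b, w x ^ 2) := by
  rw [psiNorm, ← intervalIntegral.integral_comp_mul_deriv_of_deriv_nonneg (a := a) (b := b)
    (f := ψ) (f' := deriv ψ) hψ.continuous.continuousOn (fun x _ => (hψ x).hasDerivAt)
    (fun x _ => (hψ' x).le)]
  congr 1
  simp only [intervalIntegral.integral_of_le hab, integral_Ioc_eq_integral_Ioo]
  refine setIntegral_congr_fun measurableSet_Ioo fun z hz => ?_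
  simp [hwv z hz]

/-- ψ-fractional Poincaré–Friedrichs inequality for the left derivative. -/
theorem psi_poincare_friedrichs_left
    (δ : ℝ) (hδ0 : 0 < δ) (hδ1 : δ < 1)
    (ψ : ℝ → ℝ) (hψ : ContDiff ℝ 1 ψ) (hmono : StrictMono ψ)
    (hbij : Function.Bijective ψ) (hψ' : ∀ t, 0 < deriv ψ t)
    (a b : ℝ) (hab : a < b) :
    ∃ C : ℝ, 0 < C ∧ ∀ v : ℝ → ℝ,
      ContDiff ℝ (⊤ : ℕ∞) v → HasCompactSupport v → tsupport v ⊆ Set.Ioo a b →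
      psiNorm ψ a b v ≤ C * psiNorm ψ a b (leftPsiD ψ a δ v) := by
  have hd : Differentiable ℝ ψ := hψ.differentiable one_ne_zero
  have hδ' : 0 < 1 - δ := by linarith
  have hAB : ψ a < ψ b := hmono hab
  set M := ψ b - ψ a + 1 with hM
  set K := truncKernel M δ with hK
  refine ⟨(∫ u, ‖K u‖) + 1, by positivity, fun v hv hvc hvs => ?_⟩
  let φ : ℝ ≃ₜ ℝ := (hmono.orderIsoOfSurjective ψ hbij.2).toHomeomorph
  have hφψ : ∀ z, φ.symm (ψ z) = z := φ.symm_apply_apply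
  have hψφ : ∀ x, ψ (φ.symm x) = x := φ.apply_symm_apply
  have hφ : ContDiff ℝ 1 φ.symm :=
    φ.contDiff_symm_deriv (fun x => (hψ' x).ne') (fun x => (hd x).hasDerivAt) hψ
  set w : ℝ → ℝ := v ∘ φ.symm with hw_def
  have hw : ContDiff ℝ 1 w := (hv.of_le (by exact_mod_cast le_top)).comp hφ
  have hwc : HasCompactSupport w := hvc.comp_homeomorph φ.symm
  have hwv : ∀ z, w (ψ z) = v z := fun z => by simp [hw_def, hφψ]
  have hws : tsupport w ⊆ Ioi (ψ a) := by
    intro x hx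
    have hx' : φ.symm x ∈ tsupport v := tsupport_comp_subset_preimage v φ.symm.continuous hx
    have := hmono (hvs hx').1
    rwa [hψφ] at this
  have hw0 : ∀ x ≤ ψ a, w x = 0 := fun x hx =>
    image_eq_zero_of_notMem_tsupport fun h => (hws h).not_ge hx
  have hw'0 : ∀ x ≤ ψ a, deriv w x = 0 := fun x hx => by
    by_contra h
    exact (hws (support_deriv_subset (Function.mem_support.2 h))).not_ge hx
  set g : ℝ → ℝ := truncKernel M (1 - δ) ⋆ deriv w with hg_def
  have hloc := (integrable_truncKernel (M := M) hδ').locallyIntegrable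
  have hg : Continuous g :=
    hwc.deriv.continuous_convolution_right _ hloc (hw.continuous_deriv le_rfl)
  have hg0 : ∀ s ≤ ψ a, g s = 0 := by
    intro s hs
    refine integral_eq_zero_of_ae (Eventually.of_forall fun u => ?_)
    by_cases hu : 0 < u
    · simp [hw'0 (s - u) (by linarith)]
    · simp [truncKernel_of_notMem (M := M) (μ := 1 - δ) fun h => hu h.1]
  have hgv : ∀ t ∈ Ioo a b, g (ψ t) = leftPsiD ψ a δ v t := by
    intro t ht
    have hev : (fun τ => leftPsiI ψ a (1 - δ) v τ) =ᶠ[𝓝 t]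
        fun τ => (truncKernel M (1 - δ) ⋆ w) (ψ τ) := by
      filter_upwards [Ioo_mem_nhds ht.1 ht.2] with τ hτ
      exact leftPsiI_eq_truncKernel_convolution hd hψ' hwv hw0 (hmono hτ.1)
        (by linarith [hmono hτ.2])
    have hder := (hwc.hasDerivAt_convolution_right (lsmul ℝ ℝ) hloc hw (ψ t)).comp t
      (hd t).hasDerivAt
    have hder' : deriv (fun τ => (truncKernel M (1 - δ) ⋆ w) (ψ τ)) t = g (ψ t) * deriv ψ t :=
      hder.deriv
    rw [leftPsiD, hev.deriv_eq, hder']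
    field_simp [(hψ' t).ne']
  have hKg : ∀ x ∈ Icc (ψ a) (ψ b), (K ⋆ g) x = w x := fun x hx =>
    truncKernel_convolution_convolution_deriv hδ0 hδ' (by ring) hw hwc hws (by linarith [hx.2])
  have hmain := integral_sq_convolution_le (k := K) hAB.le
    (Measurable.indicator (by fun_prop) measurableSet_Ioo) (integrable_truncKernel hδ0)
    (fun u hu => truncKernel_of_notMem fun h => h.1.not_ge hu) hg hg0
    (hw.continuous.continuousOn.congr hKg)
  rw [intervalIntegral.integral_congr (g := fun x => w x ^ 2) fun x hx => by
    rw [uIcc_of_le hAB.le] at hx; simp only [hKg x hx]] at hmain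
  rw [psiNorm_eq_sqrt_integral hab.le hd hψ' fun z _ => hwv z,
    psiNorm_eq_sqrt_integral hab.le hd hψ' hgv]
  refine (Real.sqrt_le_sqrt hmain).trans ?_
  rw [Real.sqrt_mul (by positivity), Real.sqrt_sq (by positivity)]
  gcongr
  linarith
end
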